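/- arXiv:2210.15550 — 3 statements merged into one kernel-verified Lean document; each statement's English description precedes it below -/
import Mathlib

section
/- Let ξ_t be a continuous-time random walk on ℤ with symmetric step distribution {p_i} having an exponential moment, σ² = ∑ i² p_i, and let Δ_t(x) = P(ξ_t = x) - (2πσ²t)^{-1/2} e^{-x²/(2σ²t)}. Then there is a constant C ∈ (0,∞) such that for all t > 0 and all x, y ∈ ℤ, |Δ_t(x+y) - Δ_t(x)| ≤ C|y|/t². -/
open MeasureTheory Filter
open scoped Topology ENNReal

/-- `n`-fold convolution power of a step distribution `p` on `ℤ`: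
the distribution of the discrete-time walk after `n` steps. -/
noncomputable def convPow (p : ℤ → ℝ) : ℕ → ℤ → ℝ
  | 0 => fun x => if x = 0 then 1 else 0
  | n + 1 => fun x => ∑' y : ℤ, convPow p n y * p (x - y)

/-- Distribution at time `t` of the rate-1 continuous-time random walk on `ℤ`
started at `0` with step distribution `p`: `ξ_t = S_{N_t}` with `N` a rate-1
Poisson process independent of the discrete walk `S`. -/
noncomputable def ctPMF (p : ℤ → ℝ) (t : ℝ) (x : ℤ) : ℝ :=
  ∑' n : ℕ, (Real.exp (-t) * t ^ n / n.factorial) * convPow p n x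

/-- `P_0(ξ_t > z)`. -/
noncomputable def ctTailGt (p : ℤ → ℝ) (t z : ℝ) : ℝ :=
  ∑' x : ℤ, if z < (x : ℝ) then ctPMF p t x else 0

/-- `P_0(ξ_t ≥ z)`. -/
noncomputable def ctTailGe (p : ℤ → ℝ) (t z : ℝ) : ℝ :=
  ∑' x : ℤ, if z ≤ (x : ℝ) then ctPMF p t x else 0

/-- Characteristic function of a symmetric distribution on `ℤ`. -/
noncomputable def cosTransform (p : ℤ → ℝ) (k : ℝ) : ℝ :=
  ∑' i : ℤ, p i * Real.cos (k * i)

section CosTransform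

variable {p : ℤ → ℝ}

lemma summable_mul_cos (hp0 : ∀ i, 0 ≤ p i) (hps : Summable p) (k : ℝ) :
    Summable fun i : ℤ => p i * Real.cos (k * i) := by
  refine Summable.of_norm_bounded hps fun i => ?_
  rw [Real.norm_eq_abs, abs_mul, abs_of_nonneg (hp0 i)]
  exact mul_le_of_le_one_right (hp0 i) (Real.abs_cos_le_one _)

lemma summable_mul_sin (hp0 : ∀ i, 0 ≤ p i) (hps : Summable p) (k : ℝ) :
    Summable fun i : ℤ => p i * Real.sin (k * i) := by
  refine Summable.of_norm_bounded hps fun i => ?_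
  rw [Real.norm_eq_abs, abs_mul, abs_of_nonneg (hp0 i)]
  exact mul_le_of_le_one_right (hp0 i) (Real.abs_sin_le_one _)

lemma tsum_mul_sin_eq_zero (hsym : ∀ i, p (-i) = p i) (k : ℝ) :
    ∑' i : ℤ, p i * Real.sin (k * i) = 0 := by
  have h := (Equiv.neg ℤ).tsum_eq fun i : ℤ => p i * Real.sin (k * i)
  simp only [Equiv.neg_apply, hsym, Int.cast_neg, mul_neg, Real.sin_neg, tsum_neg] at h
  linarith

lemma continuous_cosTransform (hp0 : ∀ i, 0 ≤ p i) (hps : Summable p) :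
    Continuous (cosTransform p) := by
  refine continuous_tsum (fun i => by fun_prop) hps fun i k => ?_
  rw [Real.norm_eq_abs, abs_mul, abs_of_nonneg (hp0 i)]
  exact mul_le_of_le_one_right (hp0 i) (Real.abs_cos_le_one _)

lemma abs_cosTransform_le_one (hp0 : ∀ i, 0 ≤ p i) (hps : Summable p)
    (hsum : ∑' i : ℤ, p i = 1) (k : ℝ) : |cosTransform p k| ≤ 1 := by
  rw [← hsum, ← Real.norm_eq_abs]
  refine tsum_of_norm_bounded hps.hasSum fun i => ?_
  rw [Real.norm_eq_abs, abs_mul, abs_of_nonneg (hp0 i)]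
  exact mul_le_of_le_one_right (hp0 i) (Real.abs_cos_le_one _)

lemma hasSum_mul_cos_sub (hp0 : ∀ i, 0 ≤ p i) (hsym : ∀ i, p (-i) = p i) (hps : Summable p)
    (x : ℤ) (k : ℝ) :
    HasSum (fun z : ℤ => p z * Real.cos (k * ((x - z : ℤ) : ℝ)))
      (cosTransform p k * Real.cos (k * x)) := by
  have h1 := (summable_mul_cos hp0 hps k).hasSum.mul_right (Real.cos (k * x))
  have h2 := (summable_mul_sin hp0 hps k).hasSum.mul_right (Real.sin (k * x))
  rw [tsum_mul_sin_eq_zero hsym, zero_mul] at h2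
  have h3 := h1.add h2
  rw [add_zero] at h3
  refine h3.congr_fun ?_
  intro z
  push_cast
  rw [mul_sub, Real.cos_sub]
  ring

lemma integral_cos_mul_int (x : ℤ) :
    ∫ k in (-Real.pi)..Real.pi, Real.cos (k * x) = if x = 0 then 2 * Real.pi else 0 := by
  split_ifs with h
  · subst h
    simp
    ring
  · have hx : (x : ℝ) ≠ 0 := by exact_mod_cast h
    rw [intervalIntegral.integral_comp_mul_right _ hx]
    have h1 : Real.sin (Real.pi * x) = 0 := by rw [mul_comm]; exact Real.sin_int_mul_pi x
    simp [h1]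

lemma convPow_eq_integral (hp0 : ∀ i, 0 ≤ p i) (hsym : ∀ i, p (-i) = p i) (hps : Summable p)
    (hsum : ∑' i : ℤ, p i = 1) (n : ℕ) (x : ℤ) :
    convPow p n x = (2 * Real.pi)⁻¹ *
      ∫ k in (-Real.pi)..Real.pi, cosTransform p k ^ n * Real.cos (k * x) := by
  have hc := continuous_cosTransform hp0 hps
  induction n generalizing x with
  | zero =>
    simp only [convPow, pow_zero, one_mul]
    rw [integral_cos_mul_int]
    split_ifs
    · field_simp
    · simp
  | succ n ih =>
    have key : HasSum (fun z : ℤ => ∫ k in (-Real.pi)..Real.pi,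
        p z * (cosTransform p k ^ n * Real.cos (k * ((x - z : ℤ) : ℝ))))
        (∫ k in (-Real.pi)..Real.pi, cosTransform p k ^ (n + 1) * Real.cos (k * x)) := by
      refine intervalIntegral.hasSum_integral_of_dominated_convergence (fun z _ => p z)
        (fun z => by fun_prop) (fun z => ?_) (by simp [hps]) (by simp) ?_
      · refine .of_forall fun k _ => ?_
        rw [Real.norm_eq_abs, abs_mul, abs_of_nonneg (hp0 z), abs_mul, abs_pow]
        refine mul_le_of_le_one_right (hp0 z) (mul_le_one₀ ?_ (abs_nonneg _) ?_)
        · exact pow_le_one₀ (abs_nonneg _) (abs_cosTransform_le_one hp0 hps hsum k)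
        · exact Real.abs_cos_le_one _
      · refine .of_forall fun k _ => ?_
        have h := (hasSum_mul_cos_sub hp0 hsym hps x k).mul_left (cosTransform p k ^ n)
        rw [pow_succ, mul_assoc]
        exact h.congr_fun fun z => by ring
    have h2 : ∑' y : ℤ, convPow p n y * p (x - y) = ∑' z : ℤ, convPow p n (x - z) * p z := by
      rw [← (Equiv.subLeft x).tsum_eq]
      simp
    simp only [convPow]
    rw [h2, ← key.tsum_eq, ← tsum_mul_left]
    refine tsum_congr fun z => ?_
    rw [ih, intervalIntegral.integral_const_mul]
    ring

lemma ctPMF_eq_integral (hp0 : ∀ i, 0 ≤ p i) (hsym : ∀ i, p (-i) = p i) (hps : Summable p)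
    (hsum : ∑' i : ℤ, p i = 1) {t : ℝ} (ht : 0 ≤ t) (x : ℤ) :
    ctPMF p t x = (2 * Real.pi)⁻¹ * ∫ k in (-Real.pi)..Real.pi,
      Real.exp (-(t * (1 - cosTransform p k))) * Real.cos (k * x) := by
  have hc := continuous_cosTransform hp0 hps
  have hexpsum (s : ℝ) : HasSum (fun n : ℕ => s ^ n / n.factorial) (Real.exp s) := by
    rw [Real.exp_eq_exp_ℝ]
    exact NormedSpace.expSeries_div_hasSum_exp s
  have key : HasSum (fun n : ℕ => ∫ k in (-Real.pi)..Real.pi,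
      (Real.exp (-t) * t ^ n / n.factorial) * (cosTransform p k ^ n * Real.cos (k * x)))
      (∫ k in (-Real.pi)..Real.pi,
        Real.exp (-(t * (1 - cosTransform p k))) * Real.cos (k * x)) := by
    have hs : Summable fun n : ℕ => Real.exp (-t) * t ^ n / n.factorial := by
      simp_rw [mul_div_assoc]
      exact (hexpsum t).summable.mul_left _
    refine intervalIntegral.hasSum_integral_of_dominated_convergence
      (fun n _ => Real.exp (-t) * t ^ n / n.factorial)
      (fun z => by fun_prop) (fun n => ?_) (.of_forall fun _ _ => hs) (by simp) ?_
    · refine .of_forall fun k _ => ?_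
      have h0 : 0 ≤ Real.exp (-t) * t ^ n / n.factorial := by positivity
      rw [Real.norm_eq_abs, abs_mul, abs_of_nonneg h0, abs_mul, abs_pow]
      refine mul_le_of_le_one_right h0 (mul_le_one₀ ?_ (abs_nonneg _) ?_)
      · exact pow_le_one₀ (abs_nonneg _) (abs_cosTransform_le_one hp0 hps hsum k)
      · exact Real.abs_cos_le_one _
    · refine .of_forall fun k _ => ?_
      have h := ((hexpsum (t * cosTransform p k)).mul_left (Real.exp (-t))).mul_right
        (Real.cos (k * x))
      rw [← Real.exp_add] at h
      have e : -t + t * cosTransform p k = -(t * (1 - cosTransform p k)) := by ring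
      rw [e] at h
      exact h.congr_fun fun n => by rw [mul_pow]; ring
  rw [ctPMF, ← key.tsum_eq, ← tsum_mul_left]
  refine tsum_congr fun n => ?_
  rw [convPow_eq_integral hp0 hsym hps hsum, intervalIntegral.integral_const_mul]
  ring

lemma gaussian_eq_integral {s : ℝ} (hs : 0 < s) (x : ℝ) :
    (Real.sqrt (2 * Real.pi * s))⁻¹ * Real.exp (-x ^ 2 / (2 * s)) =
      (2 * Real.pi)⁻¹ * ∫ k : ℝ, Real.exp (-(s / 2) * k ^ 2) * Real.cos (k * x) := by
  have hb : 0 < ((s / 2 : ℝ) : ℂ).re := by simpa using hs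
  have h := fourierIntegral_gaussian hb (x : ℂ)
  have hFint : Integrable fun k : ℝ =>
      Complex.exp (Complex.I * x * k) * Complex.exp (-((s / 2 : ℝ) : ℂ) * (k : ℂ) ^ 2) := by
    refine (integrable_cexp_neg_mul_sq hb).bdd_mul (c := 1) (by fun_prop) (.of_forall fun k => ?_)
    rw [Complex.norm_exp]
    simp
  have h3 := congrArg Complex.re h
  have h2 := integral_re hFint
  simp only [RCLike.re_eq_complex_re] at h2
  rw [← h2] at h3
  have hre (k : ℝ) : (Complex.exp (Complex.I * x * k) *
      Complex.exp (-((s / 2 : ℝ) : ℂ) * (k : ℂ) ^ 2)).re =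
      Real.exp (-(s / 2) * k ^ 2) * Real.cos (k * x) := by
    have e1 : -((s / 2 : ℝ) : ℂ) * (k : ℂ) ^ 2 = ((-(s / 2) * k ^ 2 : ℝ) : ℂ) := by push_cast; ring
    have e2 : Complex.I * x * k = ((k * x : ℝ) : ℂ) * Complex.I := by push_cast; ring
    rw [e1, e2, ← Complex.ofReal_exp, Complex.re_mul_ofReal, Complex.exp_ofReal_mul_I_re]
    ring
  simp_rw [hre] at h3
  rw [h3]
  have e3 : ((Real.pi : ℂ) / ((s / 2 : ℝ) : ℂ)) ^ (1 / 2 : ℂ) =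
      ((Real.sqrt (Real.pi / (s / 2)) : ℝ) : ℂ) := by
    rw [Real.sqrt_eq_rpow, Complex.ofReal_cpow (by positivity)]
    push_cast
    rfl
  have e4 : Complex.exp (-(x : ℂ) ^ 2 / (4 * ((s / 2 : ℝ) : ℂ))) =
      ((Real.exp (-x ^ 2 / (2 * s)) : ℝ) : ℂ) := by
    push_cast
    congr 1
    ring
  rw [e3, e4, ← Complex.ofReal_mul, Complex.ofReal_re, ← mul_assoc]
  congr 1
  have e5 : Real.pi / (s / 2) = (2 * Real.pi) ^ 2 / (2 * Real.pi * s) := by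
    field_simp
  rw [e5, Real.sqrt_div (by positivity), Real.sqrt_sq (by positivity)]
  field_simp

end CosTransform

lemma abs_exp_neg_sub_exp_neg_le {a b m : ℝ} (ha : m ≤ a) (hb : m ≤ b) :
    |Real.exp (-a) - Real.exp (-b)| ≤ |a - b| * Real.exp (-m) := by
  wlog hab : a ≤ b generalizing a b
  · rw [abs_sub_comm, abs_sub_comm a]
    exact this hb ha (le_of_not_ge hab)
  have h1 : Real.exp (-b) ≤ Real.exp (-a) := Real.exp_le_exp.2 (by linarith)
  have h2 : Real.exp (-a) ≤ Real.exp (-m) := Real.exp_le_exp.2 (by linarith)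
  have h3 : Real.exp (-b) = Real.exp (-a) * Real.exp (a - b) := by
    rw [← Real.exp_add]; congr 1; ring
  have h4 := Real.add_one_le_exp (a - b)
  have h5 := Real.exp_pos (-a)
  rw [abs_of_nonneg (by linarith), abs_of_nonpos (by linarith), h3]
  calc _ ≤ -(a - b) * Real.exp (-a) := by nlinarith
    _ ≤ _ := mul_le_mul_of_nonneg_left h2 (by linarith)

lemma cos_le_one_sub_sq_div_two_add (u : ℝ) : Real.cos u ≤ 1 - u ^ 2 / 2 + u ^ 4 := by
  rcases le_total |u| 1 with h | h
  · have h1 := (abs_le.1 (Real.cos_bound h)).2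
    have h2 : |u| ^ 4 = u ^ 4 := by rw [← abs_pow, abs_of_nonneg (by positivity)]
    rw [h2] at h1
    have : 0 ≤ u ^ 4 := by positivity
    linarith
  · have h1 := Real.cos_le_one u
    have h2 : 1 ≤ u ^ 2 := by rw [← sq_abs]; exact one_le_pow₀ h
    nlinarith

lemma summable_pow_four_mul {p : ℤ → ℝ} (hp0 : ∀ i, 0 ≤ p i) (hsym : ∀ i, p (-i) = p i)
    {θ : ℝ} (hθ : 0 < θ) (hexp : Summable fun i : ℤ => Real.exp (θ * (i : ℝ)) * p i) :
    Summable fun i : ℤ => (i : ℝ) ^ 4 * p i := by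
  have h2 : Summable fun i : ℤ => Real.exp (-(θ * (i : ℝ))) * p i := by
    refine ((Equiv.neg ℤ).summable_iff.2 hexp).congr fun i => ?_
    simp [hsym]
  refine Summable.of_nonneg_of_le (fun i => by have := hp0 i; positivity) (fun i => ?_)
    ((hexp.add h2).mul_left (24 / θ ^ 4))
  rw [← add_mul, ← mul_assoc]
  refine mul_le_mul_of_nonneg_right ?_ (hp0 i)
  have h3 := Real.pow_div_factorial_le_exp |θ * i| (abs_nonneg _) 4
  have h4 : Real.exp |θ * i| ≤ Real.exp (θ * i) + Real.exp (-(θ * i)) := by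
    rcases abs_choice (θ * i) with h | h <;> rw [h] <;>
      linarith [Real.exp_pos (θ * i), Real.exp_pos (-(θ * i))]
  have h5 : |θ * i| ^ 4 = θ ^ 4 * (i : ℝ) ^ 4 := by
    rw [← abs_pow, abs_of_nonneg (by positivity), mul_pow]
  have h6 : θ ^ 4 * (i : ℝ) ^ 4 / 24 ≤ Real.exp (θ * i) + Real.exp (-(θ * i)) := by
    rw [← h5]
    simpa [Nat.factorial] using h3.trans h4
  have h7 : (i : ℝ) ^ 4 = 24 / θ ^ 4 * (θ ^ 4 * (i : ℝ) ^ 4 / 24) := by field_simp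
  rw [h7]
  gcongr

lemma cosTransform_lt_one {p : ℤ → ℝ} (hp0 : ∀ i, 0 ≤ p i) (hps : Summable p)
    (hsum : ∑' i : ℤ, p i = 1) (hirr : ∀ x : ℤ, ∃ n : ℕ, 0 < convPow p n x)
    {k : ℝ} (hk : |k| ≤ Real.pi) (hk0 : k ≠ 0) : cosTransform p k < 1 := by
  refine lt_of_le_of_ne (abs_le.1 (abs_cosTransform_le_one hp0 hps hsum k)).2 fun h => hk0 ?_
  have hs : HasSum (fun i : ℤ => p i - p i * Real.cos (k * i)) 0 := by
    have := hps.hasSum.sub (summable_mul_cos hp0 hps k).hasSum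
    rwa [hsum, ← cosTransform, h, sub_self] at this
  have hnn (i : ℤ) : 0 ≤ p i - p i * Real.cos (k * i) :=
    sub_nonneg.2 (mul_le_of_le_one_right (hp0 i) (Real.cos_le_one _))
  have hz := (hasSum_zero_iff_of_nonneg hnn).1 hs
  have hcos (i : ℤ) (hi : p i ≠ 0) : Real.cos (k * i) = 1 := by
    have h1 := congrFun hz i
    simp only [Pi.zero_apply] at h1
    exact mul_left_cancel₀ hi (by linarith)
  have hconv (n : ℕ) : ∀ x : ℤ, convPow p n x ≠ 0 → Real.cos (k * x) = 1 := by
    induction n with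
    | zero =>
      intro x hx
      by_cases h0 : x = 0
      · simp [h0]
      · simp [convPow, h0] at hx
    | succ n ih =>
      intro x hx
      obtain ⟨y, hy⟩ : ∃ y : ℤ, convPow p n y * p (x - y) ≠ 0 := by
        by_contra! hc
        simp [convPow, hc] at hx
      have h1 := ih y (left_ne_zero_of_mul hy)
      have h2 := hcos _ (right_ne_zero_of_mul hy)
      have h3 : Real.sin (k * y) = 0 := by
        have := Real.sin_sq_add_cos_sq (k * y)
        rw [h1] at this
        nlinarith
      have e : k * (x : ℝ) = k * y + k * ((x - y : ℤ) : ℝ) := by push_cast; ring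
      rw [e, Real.cos_add, h1, h2, h3]
      ring
  obtain ⟨n, hn⟩ := hirr 1
  have h1 := hconv n 1 hn.ne'
  have hpi := Real.pi_pos
  obtain ⟨hk1, hk2⟩ := abs_le.1 hk
  rw [Int.cast_one, mul_one] at h1
  exact (Real.cos_eq_one_iff_of_lt_of_lt (by linarith) (by linarith)).1 h1

lemma cosTransform_taylor {p : ℤ → ℝ} (hp0 : ∀ i, 0 ≤ p i) (hps : Summable p)
    (hsum : ∑' i : ℤ, p i = 1) (h2 : Summable fun i : ℤ => (i : ℝ) ^ 2 * p i)
    (h4 : Summable fun i : ℤ => (i : ℝ) ^ 4 * p i) (k : ℝ) :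
    1 - cosTransform p k ≤ (∑' i : ℤ, (i : ℝ) ^ 2 * p i) / 2 * k ^ 2 ∧
    (∑' i : ℤ, (i : ℝ) ^ 2 * p i) / 2 * k ^ 2 - (∑' i : ℤ, (i : ℝ) ^ 4 * p i) * k ^ 4 ≤
      1 - cosTransform p k := by
  have hc := (summable_mul_cos hp0 hps k).hasSum
  have hl := hps.hasSum.sub hc
  rw [hsum] at hl
  have hr := h2.hasSum.mul_right (k ^ 2 / 2)
  have hr' := h4.hasSum.mul_right (k ^ 4)
  constructor
  · have := hasSum_le (fun i => ?_) hl hr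
    · rw [cosTransform]; linarith
    · have := mul_le_mul_of_nonneg_left (Real.one_sub_sq_div_two_le_cos (x := k * i)) (hp0 i)
      nlinarith
  · have := hasSum_le (fun i => ?_) (hr.sub hr') hl
    · rw [cosTransform]; linarith
    · have := mul_le_mul_of_nonneg_left (cos_le_one_sub_sq_div_two_add (k * i)) (hp0 i)
      nlinarith

lemma exists_mul_sq_le_one_sub_cosTransform {p : ℤ → ℝ} (hp0 : ∀ i, 0 ≤ p i) (hps : Summable p)
    (hsum : ∑' i : ℤ, p i = 1) (hirr : ∀ x : ℤ, ∃ n : ℕ, 0 < convPow p n x)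
    {v M : ℝ} (hv : 0 < v) (hM : 0 ≤ M)
    (htaylor : ∀ k, v / 2 * k ^ 2 - M * k ^ 4 ≤ 1 - cosTransform p k) :
    ∃ c : ℝ, 0 < c ∧ c ≤ v / 2 ∧ ∀ k, |k| ≤ Real.pi → c * k ^ 2 ≤ 1 - cosTransform p k := by
  have hpi := Real.pi_pos
  set d : ℝ := v / (4 * (M + 1)) with hd
  have hdpos : 0 < d := by positivity
  have hK : IsCompact (Set.Icc (-Real.pi) Real.pi ∩ {k : ℝ | d ≤ k ^ 2}) :=
    isCompact_Icc.inter_right (isClosed_le (by fun_prop) (by fun_prop))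
  obtain ⟨m, hm, hmle⟩ := hK.exists_forall_le' (f := fun k => 1 - cosTransform p k) (a := 0)
    (continuous_const.sub (continuous_cosTransform hp0 hps)).continuousOn (fun k hk => by
      have hk0 : k ≠ 0 := by
        rintro rfl
        have : d ≤ (0 : ℝ) ^ 2 := hk.2
        norm_num at this
        linarith
      have := cosTransform_lt_one hp0 hps hsum hirr (abs_le.2 hk.1) hk0
      linarith)
  refine ⟨min (v / 4) (m / Real.pi ^ 2), by positivity, (min_le_left _ _).trans (by linarith),
    fun k hk => ?_⟩
  by_cases hkd : d ≤ k ^ 2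
  · refine le_trans ?_ (hmle k ⟨abs_le.1 hk, hkd⟩)
    have h1 : k ^ 2 ≤ Real.pi ^ 2 := sq_le_sq' (abs_le.1 hk).1 (abs_le.1 hk).2
    calc _ ≤ m / Real.pi ^ 2 * Real.pi ^ 2 := by
          gcongr
          exact min_le_right _ _
      _ = m := by field_simp
  · push Not at hkd
    refine le_trans ?_ (htaylor k)
    have h1 : (M + 1) * k ^ 2 ≤ v / 4 := by
      have : (M + 1) * d = v / 4 := by rw [hd]; field_simp
      rw [← this]
      gcongr
    have h2 : min (v / 4) (m / Real.pi ^ 2) * k ^ 2 ≤ v / 4 * k ^ 2 := by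
      gcongr
      exact min_le_left _ _
    have h3 := mul_le_mul_of_nonneg_right h1 (sq_nonneg k)
    nlinarith [sq_nonneg (k ^ 2), sq_nonneg k]

lemma integrable_abs_pow_mul_exp_neg_mul_sq {b : ℝ} (hb : 0 < b) (n : ℕ) :
    Integrable fun x : ℝ => |x| ^ n * Real.exp (-b * x ^ 2) := by
  have h := (integrable_rpow_mul_exp_neg_mul_sq hb
    (lt_of_lt_of_le (by norm_num) (Nat.cast_nonneg n) : (-1 : ℝ) < n)).norm
  refine h.congr (.of_forall fun x => ?_)
  simp [Real.rpow_natCast]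

/-- With `Δ_t(x) = P(ξ_t = x) - (2πσ²t)^{-1/2} e^{-x²/(2σ²t)}`, there is `C` with
`|Δ_t(x+y) - Δ_t(x)| ≤ C|y|/t²` for all `t > 0`, `x y : ℤ`. -/
theorem stmt5 (p : ℤ → ℝ) (hp0 : ∀ i, 0 ≤ p i) (hsym : ∀ i, p (-i) = p i)
    (hsum : ∑' i : ℤ, p i = 1)
    (hirr : ∀ x : ℤ, ∃ n : ℕ, 0 < convPow p n x)
    (θ : ℝ) (hθ : 0 < θ)
    (hexp : Summable fun i : ℤ => Real.exp (θ * (i : ℝ)) * p i)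
    (σ : ℝ) (hσ : 0 < σ) (hσ2 : σ ^ 2 = ∑' i : ℤ, (i : ℝ) ^ 2 * p i) :
    ∃ C : ℝ, 0 < C ∧ ∀ t : ℝ, 0 < t → ∀ x y : ℤ,
      |(ctPMF p t (x + y) - (Real.sqrt (2 * Real.pi * σ ^ 2 * t))⁻¹
            * Real.exp (-((x : ℝ) + (y : ℝ)) ^ 2 / (2 * σ ^ 2 * t)))
          - (ctPMF p t x - (Real.sqrt (2 * Real.pi * σ ^ 2 * t))⁻¹
            * Real.exp (-(x : ℝ) ^ 2 / (2 * σ ^ 2 * t)))|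
        ≤ C * |(y : ℝ)| / t ^ 2 := by
  have hps : Summable p := by
    by_contra h
    rw [tsum_eq_zero_of_not_summable h] at hsum
    norm_num at hsum
  have h4 := summable_pow_four_mul hp0 hsym hθ hexp
  have h2 : Summable fun i : ℤ => (i : ℝ) ^ 2 * p i := by
    by_contra h
    rw [tsum_eq_zero_of_not_summable h] at hσ2
    nlinarith
  set M : ℝ := ∑' i : ℤ, (i : ℝ) ^ 4 * p i with hMdef
  have hM : 0 ≤ M := tsum_nonneg fun i => by have := hp0 i; positivity
  have htaylor := cosTransform_taylor hp0 hps hsum h2 h4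
  rw [← hσ2, ← hMdef] at htaylor
  have hv : 0 < σ ^ 2 := by positivity
  obtain ⟨c, hc, hcv, hcle⟩ := exists_mul_sq_le_one_sub_cosTransform hp0 hps hsum hirr hv hM
    fun k => (htaylor k).2
  have hcont := continuous_cosTransform hp0 hps
  have hpi := Real.pi_pos
  set h : ℝ → ℝ := fun u =>
    M * (|u| ^ 5 * Real.exp (-c * u ^ 2)) + |u| ^ 3 * Real.exp (-c * u ^ 2) with hh
  have hh_int : Integrable h := ((integrable_abs_pow_mul_exp_neg_mul_sq hc 5).const_mul M).add
    (integrable_abs_pow_mul_exp_neg_mul_sq hc 3)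
  have hhnn : 0 ≤ ∫ u, h u := integral_nonneg fun u => by simp only [hh, Pi.zero_apply]; positivity
  refine ⟨(2 * Real.pi)⁻¹ * (∫ u, h u) + 1, by positivity, fun t ht x y => ?_⟩
  set s := Real.sqrt t with hs
  have hspos : 0 < s := Real.sqrt_pos.2 ht
  have hst : s ^ 2 = t := Real.sq_sqrt ht.le
  set S : Set ℝ := Set.Ioc (-Real.pi) Real.pi with hS
  set E : ℝ → ℝ := fun k => Real.exp (-(t * (1 - cosTransform p k))) with hE
  set G : ℝ → ℝ := fun k => S.indicator E k - Real.exp (-(σ ^ 2 * t / 2) * k ^ 2) with hG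
  have hEcont : Continuous E := by fun_prop
  have hEint : Integrable (S.indicator E) :=
    (hEcont.integrableOn_Ioc).integrable_indicator measurableSet_Ioc
  have hgint : Integrable fun k : ℝ => Real.exp (-(σ ^ 2 * t / 2) * k ^ 2) :=
    integrable_exp_neg_mul_sq (by positivity)
  have hmulcos {f : ℝ → ℝ} (hf : Integrable f) (z : ℝ) :
      Integrable fun k => f k * Real.cos (k * z) :=
    hf.mul_bdd (c := 1) (by fun_prop) (.of_forall fun k => Real.abs_cos_le_one _)
  have hdelta (z : ℤ) : ctPMF p t z - (Real.sqrt (2 * Real.pi * σ ^ 2 * t))⁻¹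
      * Real.exp (-(z : ℝ) ^ 2 / (2 * σ ^ 2 * t)) =
      (2 * Real.pi)⁻¹ * ∫ k, G k * Real.cos (k * z) := by
    have hg := gaussian_eq_integral (s := σ ^ 2 * t) (by positivity) (z : ℝ)
    rw [← mul_assoc, ← mul_assoc] at hg
    rw [hg, ctPMF_eq_integral hp0 hsym hps hsum ht.le, ← mul_sub,
      intervalIntegral.integral_of_le (by linarith), ← integral_indicator measurableSet_Ioc,
      ← integral_sub _ (hmulcos hgint z)]
    · congr 1
      refine integral_congr_ae (.of_forall fun k => ?_)
      simp only [hG, hE, hS, Set.indicator]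
      split_ifs <;> ring
    · refine (hmulcos hEint z).congr (.of_forall fun k => ?_)
      simp only [hE, hS, Set.indicator]
      split_ifs <;> ring
  have hGbound (k : ℝ) : |G k| * |k| ≤ (s ^ 3)⁻¹ * h (s * k) := by
    have hexpand : (s ^ 3)⁻¹ * h (s * k) = M * t * |k| ^ 5 * Real.exp (-(t * (c * k ^ 2))) +
        |k| ^ 3 * Real.exp (-(t * (c * k ^ 2))) := by
      have e : -c * (s * k) ^ 2 = -(t * (c * k ^ 2)) := by rw [← hst]; ring
      simp only [hh]
      rw [e, abs_mul, abs_of_pos hspos, ← hst]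
      field_simp
    rw [hexpand]
    have hek : Real.exp (-(σ ^ 2 * t / 2) * k ^ 2) = Real.exp (-(t * (σ ^ 2 / 2 * k ^ 2))) := by
      congr 1; ring
    have hm : t * (c * k ^ 2) ≤ t * (σ ^ 2 / 2 * k ^ 2) := by gcongr
    have hk4 : |k| ^ 4 = k ^ 4 := by rw [← abs_pow, abs_of_nonneg (by positivity)]
    have hnn : 0 ≤ |k| := abs_nonneg k
    by_cases hk : k ∈ S
    · have hkpi : |k| ≤ Real.pi := abs_le.2 ⟨hk.1.le, hk.2⟩
      have h1 := abs_exp_neg_sub_exp_neg_le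
        (mul_le_mul_of_nonneg_left (hcle k hkpi) ht.le) hm
      have h3 : |t * (1 - cosTransform p k) - t * (σ ^ 2 / 2 * k ^ 2)| ≤ t * (M * k ^ 4) := by
        rw [← mul_sub, abs_mul, abs_of_pos ht]
        refine mul_le_mul_of_nonneg_left (abs_le.2 ?_) ht.le
        have hM4 : 0 ≤ M * k ^ 4 := by positivity
        constructor <;> linarith [(htaylor k).1, (htaylor k).2]
      have h5 : |G k| ≤ t * (M * k ^ 4) * Real.exp (-(t * (c * k ^ 2))) := by
        simp only [hG, Set.indicator_of_mem hk, hE, hek]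
        exact h1.trans (mul_le_mul_of_nonneg_right h3 (Real.exp_pos _).le)
      calc |G k| * |k| ≤ t * (M * k ^ 4) * Real.exp (-(t * (c * k ^ 2))) * |k| := by gcongr
        _ = M * t * |k| ^ 5 * Real.exp (-(t * (c * k ^ 2))) := by rw [← hk4]; ring
        _ ≤ _ := le_add_of_nonneg_right (by positivity)
    · have hk1 : 1 ≤ |k| := by
        by_contra! hlt
        obtain ⟨ha, hb⟩ := abs_lt.1 hlt
        have := Real.pi_gt_three
        exact hk ⟨by linarith, by linarith⟩
      have h5 : |G k| ≤ Real.exp (-(t * (c * k ^ 2))) := by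
        simp only [hG, Set.indicator_of_notMem hk, hek, zero_sub, abs_neg, Real.abs_exp]
        exact Real.exp_le_exp.2 (neg_le_neg hm)
      calc |G k| * |k| ≤ Real.exp (-(t * (c * k ^ 2))) * |k| ^ 3 := by
            gcongr
            exact le_self_pow₀ hk1 (by norm_num)
        _ = |k| ^ 3 * Real.exp (-(t * (c * k ^ 2))) := mul_comm _ _
        _ ≤ _ := le_add_of_nonneg_left (by positivity)
  have hGint : Integrable G := hEint.sub hgint
  have hxy := hdelta (x + y)
  rw [Int.cast_add] at hxy
  rw [hxy, hdelta x, ← mul_sub, ← integral_sub (by simpa using hmulcos hGint (x + y : ℝ))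
    (hmulcos hGint x), abs_mul, abs_of_pos (by positivity : 0 < (2 * Real.pi)⁻¹)]
  have hbound : |∫ k, (G k * Real.cos (k * (x + y)) - G k * Real.cos (k * x))| ≤
      ∫ k, |(y : ℝ)| * (s ^ 3)⁻¹ * h (s * k) := by
    rw [← Real.norm_eq_abs]
    refine norm_integral_le_of_norm_le ((hh_int.comp_mul_left' hspos.ne').const_mul _)
      (.of_forall fun k => ?_)
    rw [Real.norm_eq_abs, ← mul_sub, abs_mul]
    have h1 := Real.abs_cos_sub_cos_le (k * (x + y)) (k * x)
    have h3 : k * ((x : ℝ) + y) - k * x = k * y := by ring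
    rw [h3, abs_mul] at h1
    calc _ ≤ |G k| * (|k| * |(y : ℝ)|) := by gcongr
      _ = |(y : ℝ)| * (|G k| * |k|) := by ring
      _ ≤ |(y : ℝ)| * ((s ^ 3)⁻¹ * h (s * k)) := mul_le_mul_of_nonneg_left (hGbound k) (abs_nonneg _)
      _ = _ := by ring
  have hscale : ∫ k, |(y : ℝ)| * (s ^ 3)⁻¹ * h (s * k) = |(y : ℝ)| * (∫ u, h u) / t ^ 2 := by
    rw [integral_const_mul, Measure.integral_comp_mul_left h s, abs_of_pos (inv_pos.2 hspos),
      smul_eq_mul, ← hst]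
    field_simp
  rw [hscale] at hbound
  calc _ ≤ (2 * Real.pi)⁻¹ * (|(y : ℝ)| * (∫ u, h u) / t ^ 2) := by gcongr
    _ = (2 * Real.pi)⁻¹ * (∫ u, h u) * |(y : ℝ)| / t ^ 2 := by ring
    _ ≤ _ := by
      gcongr
      linarith
end

section
/- Let ξ_t be a continuous-time random walk on ℤ with symmetric step distribution having an exponential moment. There is a constant C ∈ (0,∞) such that for all t > 0 and y ∈ ℤ, ∑_{x∈ℤ} |P(ξ_t = x) - P(ξ_t = x+y)| ≤ C|y|/√t. -/
open MeasureTheory Filter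
open scoped Topology ENNReal

theorem HasSum.congr_terms {ι E : Type*} [AddCommMonoid E] [TopologicalSpace E] {f g : ι → E}
    {a : E} (h : HasSum f a) (hfg : ∀ i, g i = f i) : HasSum g a :=
  funext hfg ▸ h

theorem poisson_shift {E : Type*} [NormedAddCommGroup E] [NormedSpace ℝ E] (l : ℝ)
    {g : ℕ → E} {s : E} (h : HasSum (fun n : ℕ => (l ^ n / n.factorial) • g (n + 1)) s) :
    HasSum (fun n : ℕ => (n * (l ^ n / n.factorial)) • g n) (l • s) := by
  rw [← hasSum_nat_add_iff' 1]
  convert h.const_smul l using 1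
  · ext n
    rw [smul_smul]
    congr 1
    rw [Nat.factorial_succ]
    push_cast
    field_simp
    ring
  · simp

theorem poisson_hasSum (l : ℝ) :
    HasSum (fun n : ℕ => l ^ n / n.factorial) (Real.exp l) := by
  simpa [Real.exp_eq_exp_ℝ] using NormedSpace.expSeries_div_hasSum_exp l

theorem hasSum_poisson_abs_dev_bound {l : ℝ} (hl : 0 < l) :
    HasSum (fun n : ℕ => l ^ n / n.factorial * ((√l * (1 - n / l) ^ 2 + 1 / √l) / 2))
      (Real.exp l / √l) := by
  have h0 := poisson_hasSum l
  have h1 := poisson_shift l (g := fun _ => (1 : ℝ)) (by simpa using h0)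
  have h2 := poisson_shift l (g := fun n => (n : ℝ)) (s := l * Real.exp l + Real.exp l) <| by
    convert h1.add h0 using 1
    · ext n; push_cast [smul_eq_mul]; ring
    · simp
  have hs : √l ^ 2 = l := Real.sq_sqrt hl.le
  have hs0 : √l ≠ 0 := (Real.sqrt_pos.2 hl).ne'
  have h := ((h0.mul_left ((√l + 1 / √l) / 2)).sub (h1.mul_left (√l / l))).add
    (h2.mul_left (√l / (2 * l ^ 2)))
  simp only [smul_eq_mul, mul_one] at h
  have hv : (√l + 1 / √l) / 2 * Real.exp l - √l / l * (l * Real.exp l)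
      + √l / (2 * l ^ 2) * (l * (l * Real.exp l + Real.exp l)) = Real.exp l / √l := by
    field_simp
    rw [hs]
    ring
  rw [hv] at h
  refine h.congr_terms fun n => ?_
  field_simp
  ring

theorem norm_one_sub_mul_exp_smul_le {A : Type*} [NormedRing A] [NormedAlgebra ℝ A]
    [CompleteSpace A] [NormOneClass A] {S : A} (hS : ‖S‖ ≤ 1) {l : ℝ} (hl : 0 < l) :
    ‖(1 - S) * NormedSpace.exp (l • S)‖ ≤ Real.exp l / √l := by
  have h0 : HasSum (fun n : ℕ => (l ^ n / n.factorial) • S ^ n) (NormedSpace.exp (l • S)) := by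
    convert NormedSpace.exp_series_hasSum_exp' (𝕂 := ℝ) (l • S) using 2 with n
    rw [smul_pow, smul_smul, div_eq_inv_mul]
  have h1 := poisson_shift l (g := fun n => S ^ n) (s := S * NormedSpace.exp (l • S)) <| by
    refine (h0.mul_left S).congr_terms fun n => ?_
    rw [pow_succ', mul_smul_comm]
  have h2 : HasSum (fun n : ℕ => (l ^ n / n.factorial * (1 - n / l)) • S ^ n)
      ((1 - S) * NormedSpace.exp (l • S)) := by
    have h := h0.sub (h1.const_smul l⁻¹)
    rw [inv_smul_smul₀ hl.ne', ← one_sub_mul] at h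
    refine h.congr_terms fun n => ?_
    rw [smul_smul, ← sub_smul]
    congr 1
    field_simp
  rw [← h2.tsum_eq]
  refine tsum_of_norm_bounded (hasSum_poisson_abs_dev_bound hl) fun n => ?_
  have hSn : ‖S ^ n‖ ≤ 1 := (norm_pow_le S n).trans (pow_le_one₀ (norm_nonneg _) hS)
  have hs : 0 < √l := Real.sqrt_pos.2 hl
  have hd : |1 - n / l| ≤ (√l * (1 - n / l) ^ 2 + 1 / √l) / 2 := by
    have h : √l * (1 - n / l) ^ 2 + 1 / √l - 2 * |1 - n / l|
        = (√l * |1 - n / l| - 1) ^ 2 / √l := by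
      rw [← sq_abs (1 - n / l)]
      field_simp
      ring
    have := div_nonneg (sq_nonneg (√l * |1 - n / l| - 1)) hs.le
    linarith
  rw [norm_smul, norm_mul, Real.norm_eq_abs, Real.norm_eq_abs, abs_of_nonneg (by positivity)]
  calc l ^ n / n.factorial * |1 - n / l| * ‖S ^ n‖
      ≤ l ^ n / n.factorial * |1 - n / l| * 1 := by gcongr
    _ ≤ _ := by rw [mul_one]; gcongr

theorem norm_exp_le_exp_norm {A : Type*} [NormedRing A] [NormedAlgebra ℝ A]
    [CompleteSpace A] [NormOneClass A] (x : A) :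
    ‖NormedSpace.exp x‖ ≤ Real.exp ‖x‖ := by
  rw [← (NormedSpace.exp_series_hasSum_exp' (𝕂 := ℝ) x).tsum_eq]
  refine tsum_of_norm_bounded (poisson_hasSum ‖x‖) fun n => ?_
  rw [norm_smul, norm_inv, Real.norm_natCast, div_eq_inv_mul]
  gcongr
  exact norm_pow_le x n

theorem norm_one_sub_mul_exp_add_le {A : Type*} [NormedRing A] [NormedAlgebra ℝ A]
    [CompleteSpace A] [NormOneClass A] {S Q : A} (hSQ : Commute S Q) (hS : ‖S‖ ≤ 1) {a : ℝ}
    (ha : 0 < a) (hQ : ‖Q‖ ≤ 1 - a) {t : ℝ} (ht : 0 < t) :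
    ‖(1 - S) * NormedSpace.exp (t • (a • S + Q))‖ ≤ Real.exp t * ((√a)⁻¹ / √t) := by
  let _ := NormedAlgebra.restrictScalars ℚ ℝ A
  have h1 : NormedSpace.exp (t • (a • S + Q))
      = NormedSpace.exp ((t * a) • S) * NormedSpace.exp (t • Q) := by
    rw [smul_add, smul_smul]
    exact NormedSpace.exp_add_of_commute ((hSQ.smul_left _).smul_right _)
  rw [h1, ← mul_assoc]
  calc _ ≤ Real.exp (t * a) / √(t * a) * Real.exp (t * (1 - a)) := by
        refine (norm_mul_le _ _).trans ?_
        refine mul_le_mul (norm_one_sub_mul_exp_smul_le hS (by positivity)) ?_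
          (norm_nonneg _) (by positivity)
        refine (norm_exp_le_exp_norm _).trans (Real.exp_le_exp.2 ?_)
        rw [norm_smul, Real.norm_of_nonneg ht.le]
        gcongr
    _ = _ := by
        rw [Real.sqrt_mul ht.le, div_mul_eq_mul_div, ← Real.exp_add]
        field_simp
        ring_nf

/-- The Banach space `ℓ¹(ℤ)`. -/
abbrev EllOne : Type := lp (fun _ : ℤ => ℝ) 1

theorem EllOne.norm_eq (f : EllOne) : ‖f‖ = ∑' x, |f x| := by
  simpa using lp.norm_eq_tsum_rpow (p := 1) (by simp) f

theorem EllOne.summable_abs (f : EllOne) : Summable fun x => |f x| := by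
  simpa using (lp.memℓp f).summable (by simp)

/-- Translation by `y` on `ℓ¹(ℤ)`: `(shift y f) x = f (x - y)`. -/
noncomputable def EllOne.shift (y : ℤ) : EllOne →L[ℝ] EllOne :=
  LinearMap.mkContinuous
    { toFun := fun f => ⟨fun x => f (x - y), memℓp_gen <| by
        simpa [Function.comp_def] using (Equiv.subRight y).summable_iff.2 f.summable_abs⟩
      map_add' := fun _ _ => rfl
      map_smul' := fun _ _ => rfl } 1 fun f => by
    rw [one_mul, EllOne.norm_eq, EllOne.norm_eq]
    exact ((Equiv.subRight y).tsum_eq fun x => |f x|).le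

namespace EllOne

@[simp]
theorem shift_apply (y : ℤ) (f : EllOne) (x : ℤ) : shift y f x = f (x - y) := rfl

theorem norm_shift_le (y : ℤ) : ‖shift y‖ ≤ 1 :=
  LinearMap.mkContinuous_norm_le _ zero_le_one _

theorem shift_zero : shift 0 = 1 := by
  ext f x
  simp

theorem shift_add (y z : ℤ) : shift (y + z) = shift y * shift z := by
  ext f x
  simp [sub_sub]

theorem commute_shift (y z : ℤ) : Commute (shift y) (shift z) := by
  rw [Commute, SemiconjBy, ← shift_add, ← shift_add, add_comm]

instance : Nontrivial EllOne :=
  ⟨lp.single 1 0 1, 0, fun h => by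
    simpa using congrArg (fun f : EllOne => f 0) h⟩

/-- Convolution with a summable function `p`, as an operator on `ℓ¹(ℤ)`. -/
noncomputable def convOp (p : ℤ → ℝ) : EllOne →L[ℝ] EllOne := ∑' i, p i • shift i

variable {p : ℤ → ℝ}

theorem norm_smul_shift_le (hp0 : ∀ i, 0 ≤ p i) (i : ℤ) : ‖p i • shift i‖ ≤ p i := by
  rw [norm_smul, Real.norm_of_nonneg (hp0 i)]
  exact mul_le_of_le_one_right (hp0 i) (norm_shift_le i)

theorem summable_smul_shift (hp0 : ∀ i, 0 ≤ p i) (hp : Summable p) :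
    Summable fun i => p i • shift i :=
  .of_norm_bounded hp (norm_smul_shift_le hp0)

theorem convOp_apply (hp0 : ∀ i, 0 ≤ p i) (hp : Summable p) (f : EllOne) (x : ℤ) :
    convOp p f x = ∑' y, f y * p (x - y) := by
  have h : HasSum (fun i => p i * f (x - i)) (convOp p f x) :=
    (summable_smul_shift hp0 hp).hasSum.mapL
      ((lp.evalCLM ℝ (fun _ : ℤ => ℝ) 1 x).comp (ContinuousLinearMap.apply ℝ EllOne f))
  rw [← h.tsum_eq, ← (Equiv.subLeft x).tsum_eq fun i => p i * f (x - i)]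
  exact tsum_congr fun y => by simp [mul_comm]

theorem convOp_pow_apply (hp0 : ∀ i, 0 ≤ p i) (hp : Summable p) (n : ℕ) (x : ℤ) :
    (convOp p ^ n) (lp.single 1 0 1) x = convPow p n x := by
  induction n generalizing x with
  | zero => simp [convPow, lp.single_apply, Pi.single_apply]
  | succ n ih =>
    rw [pow_succ', mul_apply_eq_comp, convOp_apply hp0 hp, convPow]
    simp only [ih]

theorem ctPMF_eq (hp0 : ∀ i, 0 ≤ p i) (hp : Summable p) (t : ℝ) (x : ℤ) :
    ctPMF p t x = Real.exp (-t) * NormedSpace.exp (t • convOp p) (lp.single 1 0 1) x := by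
  have h := (NormedSpace.exp_series_hasSum_exp' (𝕂 := ℝ) (t • convOp p)).mapL
    ((lp.evalCLM ℝ (fun _ : ℤ => ℝ) 1 x).comp
      (ContinuousLinearMap.apply ℝ EllOne (lp.single 1 0 1)))
  refine ((h.mul_left (Real.exp (-t))).congr_terms fun n => ?_).tsum_eq
  change _ = Real.exp (-t) * (((n.factorial : ℝ)⁻¹ • (t • convOp p) ^ n) (lp.single 1 0 1)) x
  rw [smul_pow, smul_smul, smul_apply, lp.coeFn_smul, Pi.smul_apply,
    convOp_pow_apply hp0 hp, smul_eq_mul]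
  ring

theorem exists_convOp_eq (hp0 : ∀ i, 0 ≤ p i) (hp : HasSum p 1) (j : ℤ) :
    ∃ Q : EllOne →L[ℝ] EllOne, convOp p = p j • shift j + Q ∧ Commute (shift j) Q ∧
      ‖Q‖ ≤ 1 - p j := by
  have hs := summable_smul_shift hp0 hp.summable
  refine ⟨convOp p - p j • shift j, by abel, ?_, ?_⟩
  · refine Commute.sub_right ?_ ((Commute.refl _).smul_right _)
    exact Commute.tsum_right _ fun i => (commute_shift j i).smul_right _
  · rw [convOp, hs.tsum_eq_add_tsum_ite j, add_sub_cancel_left]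
    have h := hp.sub (hasSum_ite_eq j (p j))
    refine tsum_of_norm_bounded h fun i => ?_
    split_ifs with hi
    · simp [hi]
    · simpa using norm_smul_shift_le hp0 i

theorem convPow_nonneg (hp0 : ∀ i, 0 ≤ p i) (n : ℕ) (x : ℤ) : 0 ≤ convPow p n x := by
  induction n generalizing x with
  | zero => rw [convPow]; positivity
  | succ n ih => exact tsum_nonneg fun y => mul_nonneg (ih y) (hp0 _)

theorem norm_one_sub_shift_add_mul_le (y z : ℤ) (U : EllOne →L[ℝ] EllOne) :
    ‖(1 - shift (y + z)) * U‖ ≤ ‖(1 - shift y) * U‖ + ‖(1 - shift z) * U‖ := by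
  have h : (1 - shift (y + z)) * U
      = (1 - shift y) * U + shift y * ((1 - shift z) * U) := by
    rw [shift_add]
    noncomm_ring
  rw [h]
  refine (norm_add_le _ _).trans (add_le_add le_rfl ((norm_mul_le _ _).trans ?_))
  exact mul_le_of_le_one_left (norm_nonneg _) (norm_shift_le y)

theorem norm_one_sub_shift_neg_mul_le (y : ℤ) (U : EllOne →L[ℝ] EllOne) :
    ‖(1 - shift (-y)) * U‖ ≤ ‖(1 - shift y) * U‖ := by
  have h : (1 - shift (-y)) * U = -(shift (-y) * ((1 - shift y) * U)) := by
    have h' : shift (-y) * shift y = 1 := by rw [← shift_add, neg_add_cancel, shift_zero]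
    rw [← mul_assoc, mul_sub, h', mul_one, ← neg_mul, neg_sub]
  rw [h, norm_neg]
  refine (norm_mul_le _ _).trans ?_
  exact mul_le_of_le_one_left (norm_nonneg _) (norm_shift_le _)

theorem norm_one_sub_shift_natCast_mul_le (n : ℕ) (U : EllOne →L[ℝ] EllOne) :
    ‖(1 - shift n) * U‖ ≤ n * ‖(1 - shift 1) * U‖ := by
  induction n with
  | zero => simp [shift_zero]
  | succ n ih =>
    push_cast
    refine (norm_one_sub_shift_add_mul_le _ _ U).trans ?_
    linarith

theorem norm_one_sub_shift_mul_le (y : ℤ) (U : EllOne →L[ℝ] EllOne) :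
    ‖(1 - shift y) * U‖ ≤ |(y : ℝ)| * ‖(1 - shift 1) * U‖ := by
  obtain ⟨n, rfl | rfl⟩ := y.eq_nat_or_neg
  · simpa using norm_one_sub_shift_natCast_mul_le n U
  · simpa using (norm_one_sub_shift_neg_mul_le n U).trans
      (norm_one_sub_shift_natCast_mul_le n U)

theorem exists_norm_one_sub_shift_mul_exp_le (hp0 : ∀ i, 0 ≤ p i) (hp : HasSum p 1)
    {n : ℕ} {x : ℤ} (hx : 0 < convPow p n x) :
    ∃ C : ℝ, ∀ t : ℝ, 0 < t →
      ‖(1 - shift x) * NormedSpace.exp (t • convOp p)‖ ≤ Real.exp t * (C / √t) := by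
  induction n generalizing x with
  | zero =>
    obtain rfl : x = 0 := by
      by_contra h
      simp [convPow, h] at hx
    exact ⟨0, fun t _ => by simp [shift_zero]⟩
  | succ n ih =>
    obtain ⟨y, hy⟩ : ∃ y, convPow p n y * p (x - y) ≠ 0 := by
      by_contra! h
      simp [convPow, h] at hx
    obtain ⟨C, hC⟩ := ih ((convPow_nonneg hp0 n y).lt_of_ne' (left_ne_zero_of_mul hy))
    obtain ⟨Q, hPQ, hQ, hQn⟩ := exists_convOp_eq hp0 hp (x - y)
    have hpos := (hp0 (x - y)).lt_of_ne' (right_ne_zero_of_mul hy)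
    refine ⟨C + (√(p (x - y)))⁻¹, fun t ht => ?_⟩
    have h := norm_one_sub_shift_add_mul_le y (x - y) (NormedSpace.exp (t • convOp p))
    rw [add_sub_cancel] at h
    rw [add_div, mul_add]
    refine h.trans (add_le_add (hC t ht) ?_)
    rw [hPQ]
    exact norm_one_sub_mul_exp_add_le hQ (norm_shift_le _) hpos hQn ht

theorem tsum_abs_ctPMF_sub_eq (hp0 : ∀ i, 0 ≤ p i) (hp : Summable p) (t : ℝ) (y : ℤ) :
    ∑' x : ℤ, |ctPMF p t x - ctPMF p t (x + y)| = Real.exp (-t) *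
      ‖((1 - shift (-y)) * NormedSpace.exp (t • convOp p)) (lp.single 1 0 1)‖ := by
  rw [norm_eq, ← tsum_mul_left]
  refine tsum_congr fun x => ?_
  rw [ctPMF_eq hp0 hp, ctPMF_eq hp0 hp, ← mul_sub, abs_mul, abs_of_pos (Real.exp_pos _)]
  simp

end EllOne

/-- Total-variation type gradient estimate:
`∑_x |P(ξ_t = x) - P(ξ_t = x+y)| ≤ C|y|/√t`. -/
theorem stmt6 (p : ℤ → ℝ) (hp0 : ∀ i, 0 ≤ p i) (hsym : ∀ i, p (-i) = p i)
    (hsum : ∑' i : ℤ, p i = 1)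
    (hirr : ∀ x : ℤ, ∃ n : ℕ, 0 < convPow p n x)
    (θ : ℝ) (hθ : 0 < θ)
    (hexp : Summable fun i : ℤ => Real.exp (θ * (i : ℝ)) * p i)
    (σ : ℝ) (hσ : 0 < σ) (hσ2 : σ ^ 2 = ∑' i : ℤ, (i : ℝ) ^ 2 * p i) :
    ∃ C : ℝ, 0 < C ∧ ∀ t : ℝ, 0 < t → ∀ y : ℤ,
      (∑' x : ℤ, |ctPMF p t x - ctPMF p t (x + y)|) ≤ C * |(y : ℝ)| / Real.sqrt t := by
  have hp : HasSum p 1 := by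
    refine hsum ▸ Summable.hasSum ?_
    by_contra h
    simp [tsum_eq_zero_of_not_summable h] at hsum
  obtain ⟨n, hn⟩ := hirr 1
  obtain ⟨C, hC⟩ := EllOne.exists_norm_one_sub_shift_mul_exp_le hp0 hp hn
  refine ⟨|C| + 1, by positivity, fun t ht y => ?_⟩
  set U := NormedSpace.exp (t • EllOne.convOp p)
  have hC' : C ≤ |C| + 1 := (le_abs_self C).trans (by linarith)
  have hδ : ‖(lp.single 1 0 1 : EllOne)‖ = 1 := by
    rw [lp.norm_single one_pos, norm_one]
  rw [EllOne.tsum_abs_ctPMF_sub_eq hp0 hp.summable]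
  calc Real.exp (-t) * ‖((1 - EllOne.shift (-y)) * U) (lp.single 1 0 1)‖
      ≤ Real.exp (-t) * (|(y : ℝ)| * (Real.exp t * ((|C| + 1) / √t))) := by
        gcongr
        refine (ContinuousLinearMap.le_opNorm _ _).trans ?_
        rw [hδ, mul_one]
        refine (EllOne.norm_one_sub_shift_mul_le _ U).trans ?_
        rw [Int.cast_neg, abs_neg]
        gcongr
        exact (hC t ht).trans (by gcongr)
    _ = (|C| + 1) * |(y : ℝ)| / √t := by
        rw [Real.exp_neg]
        field_simp
end

section
/- For the full-step initial configuration η(k) = 1 iff k ≤ 0 in the symmetric exclusion process with finite-range symmetric jump rates, the covariance sum 𝒞_t(η,z) = -∑_{j≠k, j,k>z} Cov_η(η_t(j), η_t(k)) with z = σ b_t(x+a_t), a_t = log(t/(√(2π)log t)), b_t = √(t/log t), satisfies 𝒞_t(η,z) = O(e^{-2x}(log t)²/√t) as t → ∞. -/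
open MeasureTheory Filter
open scoped Topology ENNReal

/-- One-particle exclusion (= random walk) semigroup applied to a profile `η`:
by duality, `E_η[η_t(k)] = E_k[η(ξ_t)] = ∑_y P₀(ξ_t = y - k) η(y)`. -/
noncomputable def oneP (p : ℤ → ℝ) (η : ℤ → ℝ) (s : ℝ) (k : ℤ) : ℝ :=
  ∑' y : ℤ, ctPMF p s (y - k) * η y

/-- Generator `𝒱` of two exclusion particles on `ℤ` with symmetric rates `p`. -/
noncomputable def twoGen (p : ℤ → ℝ) (f : ℤ → ℤ → ℝ) (x y : ℤ) : ℝ :=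
  (∑' z : ℤ, if z ≠ y then p (z - x) * (f z y - f x y) else 0)
    + ∑' z : ℤ, if z ≠ x then p (z - y) * (f x z - f x y) else 0

/-- Expectation of `a N` for `N` a Poisson variable with mean `s`. -/
noncomputable def poissonAvg (a : ℕ → ℝ) (s : ℝ) : ℝ :=
  ∑' n : ℕ, (Real.exp (-s) * s ^ n / n.factorial) * a n

theorem poissonAvg_eq (a : ℕ → ℝ) (s : ℝ) :
    poissonAvg a s = Real.exp (-s) * ∑' n : ℕ, s ^ n / n.factorial * a n := by
  rw [poissonAvg, ← tsum_mul_left]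
  exact tsum_congr fun n => by ring

theorem summable_pow_div_factorial_mul {a : ℕ → ℝ} {B R : ℝ} (ha : ∀ n, |a n| ≤ B * R ^ n)
    (s : ℝ) : Summable fun n : ℕ => s ^ n / n.factorial * a n := by
  refine Summable.of_norm_bounded
    ((Real.summable_pow_div_factorial (|s| * R)).mul_left B) fun n => ?_
  rw [norm_mul, Real.norm_eq_abs, Real.norm_eq_abs, abs_div, abs_pow, Nat.abs_cast, mul_pow]
  calc |s| ^ n / n.factorial * |a n| ≤ |s| ^ n / n.factorial * (B * R ^ n) := by gcongr; exact ha n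
    _ = _ := by ring

theorem summable_poisson_mul {a : ℕ → ℝ} {B R : ℝ} (ha : ∀ n, |a n| ≤ B * R ^ n) (s : ℝ) :
    Summable fun n : ℕ => (Real.exp (-s) * s ^ n / n.factorial) * a n := by
  refine ((summable_pow_div_factorial_mul ha s).mul_left (Real.exp (-s))).congr fun n => by ring

theorem poissonAvg_zero (a : ℕ → ℝ) : poissonAvg a 0 = a 0 := by
  rw [poissonAvg, tsum_eq_single 0]
  · simp
  · intro n hn
    simp [hn]

theorem poissonAvg_pow (R s : ℝ) : poissonAvg (fun n => R ^ n) s = Real.exp (s * (R - 1)) := by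
  have h : ∀ n : ℕ, s ^ n / n.factorial * R ^ n = (s * R) ^ n / n.factorial := fun n => by
    rw [mul_pow]; ring
  rw [poissonAvg_eq, tsum_congr h, (NormedSpace.expSeries_div_hasSum_exp (s * R)).tsum_eq,
    ← Real.exp_eq_exp_ℝ, ← Real.exp_add]
  congr 1; ring

theorem poissonAvg_mono {a b : ℕ → ℝ} {A B R S s : ℝ} (hs : 0 ≤ s)
    (ha : ∀ n, |a n| ≤ A * R ^ n) (hb : ∀ n, |b n| ≤ B * S ^ n) (hab : ∀ n, a n ≤ b n) :
    poissonAvg a s ≤ poissonAvg b s :=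
  (summable_poisson_mul ha s).tsum_le_tsum
    (fun n => mul_le_mul_of_nonneg_left (hab n) (by positivity)) (summable_poisson_mul hb s)

theorem poissonAvg_nonneg {a : ℕ → ℝ} {s : ℝ} (hs : 0 ≤ s) (ha : ∀ n, 0 ≤ a n) :
    0 ≤ poissonAvg a s :=
  tsum_nonneg fun n => mul_nonneg (by positivity) (ha n)

theorem poissonAvg_sum {ι : Type*} (I : Finset ι) (c : ι → ℝ) {a : ι → ℕ → ℝ} {B R : ℝ}
    (ha : ∀ i n, |a i n| ≤ B * R ^ n) (s : ℝ) :
    poissonAvg (fun n => ∑ i ∈ I, c i * a i n) s = ∑ i ∈ I, c i * poissonAvg (a i) s := by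
  simp only [poissonAvg, ← tsum_mul_left]
  rw [← Summable.tsum_finsetSum fun i _ => (summable_poisson_mul (ha i) s).mul_left (c i)]
  refine tsum_congr fun n => ?_
  rw [Finset.mul_sum]
  exact Finset.sum_congr rfl fun i _ => by ring

theorem hasDerivAt_poissonAvg {a : ℕ → ℝ} {B : ℝ} (ha : ∀ n, |a n| ≤ B) (s : ℝ) :
    HasDerivAt (poissonAvg a) (poissonAvg (fun n => a (n + 1)) s - poissonAvg a s) s := by
  have hB : 0 ≤ B := (abs_nonneg _).trans (ha 0)
  set R : ℝ := |s| + 1 with hR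
  have hR0 : 0 ≤ R := by positivity
  have hu : Summable fun n : ℕ => (n : ℝ) * R ^ (n - 1) / n.factorial * B := by
    rw [← summable_nat_add_iff 1]
    refine ((Real.summable_pow_div_factorial R).mul_right B).congr fun n => ?_
    rw [Nat.factorial_succ, Nat.add_sub_cancel]
    push_cast
    field_simp
  have key : HasDerivAt (fun y => ∑' n : ℕ, y ^ n / n.factorial * a n)
      (∑' n : ℕ, (n : ℝ) * s ^ (n - 1) / n.factorial * a n) s := by
    refine hasDerivAt_tsum_of_isPreconnected (F := ℝ)
      (g := fun (n : ℕ) (y : ℝ) => y ^ n / n.factorial * a n)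
      (g' := fun (n : ℕ) (y : ℝ) => (n : ℝ) * y ^ (n - 1) / n.factorial * a n)
      (t := Metric.ball (0 : ℝ) R) (y₀ := 0) hu Metric.isOpen_ball
      (convex_ball (0 : ℝ) R).isPreconnected ?_ ?_ ?_ ?_ ?_
    · intro n y _
      exact ((hasDerivAt_pow n y).div_const _).mul_const _
    · intro n y hy
      have hy' : |y| ≤ R := by simpa using (mem_ball_zero_iff.1 hy).le
      rw [norm_mul, norm_div, norm_mul, norm_pow, Real.norm_eq_abs y, Real.norm_natCast,
        Real.norm_natCast, Real.norm_eq_abs]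
      gcongr
      exact ha n
    · simp; positivity
    · exact summable_pow_div_factorial_mul (B := B) (R := 1) (by simpa using ha) 0
    · simp [hR]
  have hsum : ∑' n : ℕ, (n : ℝ) * s ^ (n - 1) / n.factorial * a n
      = ∑' n : ℕ, s ^ n / n.factorial * a (n + 1) := by
    have hterm : ∀ n : ℕ, ((n + 1 : ℕ) : ℝ) * s ^ (n + 1 - 1) / (n + 1).factorial * a (n + 1)
        = s ^ n / n.factorial * a (n + 1) := fun n => by
      rw [Nat.factorial_succ, Nat.add_sub_cancel]
      push_cast
      field_simp
    have hsm : Summable fun n : ℕ => (n : ℝ) * s ^ (n - 1) / n.factorial * a n := by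
      rw [← summable_nat_add_iff 1]
      refine (summable_pow_div_factorial_mul (a := fun n => a (n + 1)) (B := B) (R := 1)
        (fun n => by simpa using ha (n + 1)) s).congr fun n => (hterm n).symm
    rw [hsm.tsum_eq_zero_add, tsum_congr hterm]
    simp
  have h1 : HasDerivAt (fun y : ℝ => Real.exp (-y)) (-Real.exp (-s)) s := by
    simpa using (hasDerivAt_neg s).exp
  have h2 := h1.mul key
  have h3 : poissonAvg a = fun y => Real.exp (-y) * ∑' n : ℕ, y ^ n / n.factorial * a n :=
    funext fun y => poissonAvg_eq a y
  rw [h3]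
  refine h2.congr_deriv ?_
  rw [hsum, poissonAvg_eq]
  ring

/-- A symmetric probability distribution on `ℤ` supported in `[-r, r]`. -/
structure IsSymmStep (p : ℤ → ℝ) (r : ℕ) : Prop where
  nonneg : ∀ i, 0 ≤ p i
  symm : ∀ i, p (-i) = p i
  support : ∀ i : ℤ, (r : ℤ) < |i| → p i = 0
  sum_eq_one : ∑ i ∈ Finset.Icc (-(r : ℤ)) r, p i = 1

/-- `E[f(j + ξ)]` for a single step `ξ` of the walk. -/
noncomputable def stepSum (p : ℤ → ℝ) (r : ℕ) (f : ℤ → ℝ) (j : ℤ) : ℝ :=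
  ∑ i ∈ Finset.Icc (-(r : ℤ)) r, p i * f (j + i)

/-- `E[f(j + S_n)]` for the discrete walk `S`. -/
noncomputable def stepIter (p : ℤ → ℝ) (r : ℕ) (f : ℤ → ℝ) : ℕ → ℤ → ℝ
  | 0 => f
  | n + 1 => stepSum p r (stepIter p r f n)

theorem stepIter_zero (p : ℤ → ℝ) (r : ℕ) (f : ℤ → ℝ) (j : ℤ) : stepIter p r f 0 j = f j := by
  rw [stepIter]

theorem stepIter_succ (p : ℤ → ℝ) (r : ℕ) (f : ℤ → ℝ) (n : ℕ) (j : ℤ) :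
    stepIter p r f (n + 1) j
      = ∑ i ∈ Finset.Icc (-(r : ℤ)) r, p i * stepIter p r f n (j + i) := by
  rw [stepIter, stepSum]

/-- `E[exp(l ξ)]` for a single step `ξ` of the walk. -/
noncomputable def stepMgf (p : ℤ → ℝ) (r : ℕ) (l : ℝ) : ℝ :=
  ∑ i ∈ Finset.Icc (-(r : ℤ)) r, p i * Real.exp (l * i)

/-- The heat flow `E[f(j + ξ_s)]` for the rate-1 continuous-time walk `ξ`. -/
noncomputable def heatFlow (p : ℤ → ℝ) (r : ℕ) (f : ℤ → ℝ) (s : ℝ) (j : ℤ) : ℝ :=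
  poissonAvg (fun n => stepIter p r f n j) s

theorem sum_Icc_neg_symm (r : ℕ) (f : ℤ → ℝ) :
    ∑ i ∈ Finset.Icc (-(r : ℤ)) r, f (-i) = ∑ i ∈ Finset.Icc (-(r : ℤ)) r, f i := by
  refine Finset.sum_nbij' (fun i => -i) (fun i => -i) ?_ ?_ ?_ ?_ ?_ <;> simp
  · intro a h1 h2; constructor <;> linarith
  · intro a h1 h2; constructor <;> linarith

namespace IsSymmStep

variable {p : ℤ → ℝ} {r : ℕ}

theorem tsum_eq_sum (hp : IsSymmStep p r) (f : ℤ → ℝ) :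
    ∑' i, p i * f i = ∑ i ∈ Finset.Icc (-(r : ℤ)) r, p i * f i := by
  refine _root_.tsum_eq_sum fun i hi => ?_
  rw [hp.support i, zero_mul]
  by_contra hc
  exact hi (Finset.mem_Icc.2 (abs_le.1 (not_lt.1 hc)))

theorem stepMgf_neg (hp : IsSymmStep p r) (l : ℝ) : stepMgf p r (-l) = stepMgf p r l := by
  rw [stepMgf, ← sum_Icc_neg_symm]
  exact Finset.sum_congr rfl fun i _ => by rw [hp.symm]; push_cast; ring_nf

theorem stepMgf_eq_cosh (hp : IsSymmStep p r) (l : ℝ) :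
    stepMgf p r l = ∑ i ∈ Finset.Icc (-(r : ℤ)) r, p i * Real.cosh (l * i) := by
  have h1 : stepMgf p r l = (stepMgf p r l + stepMgf p r (-l)) / 2 := by rw [hp.stepMgf_neg]; ring
  rw [h1, stepMgf, stepMgf, ← Finset.sum_add_distrib, Finset.sum_div]
  exact Finset.sum_congr rfl fun i _ => by rw [Real.cosh_eq]; ring_nf

theorem one_le_stepMgf (hp : IsSymmStep p r) (l : ℝ) : 1 ≤ stepMgf p r l := by
  rw [hp.stepMgf_eq_cosh, ← hp.sum_eq_one]
  exact Finset.sum_le_sum fun i _ => le_mul_of_one_le_right (hp.nonneg i) (Real.one_le_cosh _)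

theorem stepIter_nonneg (hp : IsSymmStep p r) {f : ℤ → ℝ} (hf : ∀ j, 0 ≤ f j) (n : ℕ) (j : ℤ) :
    0 ≤ stepIter p r f n j := by
  induction n generalizing j with
  | zero => simpa [stepIter_zero] using hf j
  | succ n ih =>
    rw [stepIter_succ]
    exact Finset.sum_nonneg fun i _ => mul_nonneg (hp.nonneg i) (ih _)

theorem stepIter_mul_exp_le (hp : IsSymmStep p r) {f : ℤ → ℝ} {l : ℝ}
    (hf : ∀ j : ℤ, f j * Real.exp (l * j) ≤ 1) (n : ℕ) (j : ℤ) :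
    stepIter p r f n j * Real.exp (l * j) ≤ stepMgf p r l ^ n := by
  induction n generalizing j with
  | zero => simpa [stepIter_zero] using hf j
  | succ n ih =>
    rw [stepIter_succ, Finset.sum_mul, pow_succ']
    nth_rw 1 [← hp.stepMgf_neg]
    rw [stepMgf, Finset.sum_mul]
    refine Finset.sum_le_sum fun i _ => ?_
    calc p i * stepIter p r f n (j + i) * Real.exp (l * j)
        = p i * Real.exp (-l * i) * (stepIter p r f n (j + i) * Real.exp (l * (j + i : ℤ))) := by
          have : Real.exp (l * j) = Real.exp (-l * i) * Real.exp (l * (j + i : ℤ)) := by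
            rw [← Real.exp_add]; push_cast; ring_nf
          rw [this]; ring
      _ ≤ _ := mul_le_mul_of_nonneg_left (ih _) (mul_nonneg (hp.nonneg i) (Real.exp_pos _).le)

theorem stepIter_le_one (hp : IsSymmStep p r) {f : ℤ → ℝ} (hf : ∀ j, f j ≤ 1) (n : ℕ) (j : ℤ) :
    stepIter p r f n j ≤ 1 := by
  have h := hp.stepIter_mul_exp_le (f := f) (l := 0) (by simpa using hf) n j
  simpa [stepMgf, hp.sum_eq_one] using h

theorem abs_stepIter_le_one (hp : IsSymmStep p r) {f : ℤ → ℝ} (h0 : ∀ j, 0 ≤ f j)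
    (h1 : ∀ j, f j ≤ 1) (n : ℕ) (j : ℤ) : |stepIter p r f n j| ≤ 1 := by
  rw [abs_of_nonneg (hp.stepIter_nonneg h0 n j)]
  exact hp.stepIter_le_one h1 n j

theorem heatFlow_nonneg (hp : IsSymmStep p r) {f : ℤ → ℝ} (hf : ∀ j, 0 ≤ f j) {s : ℝ}
    (hs : 0 ≤ s) (j : ℤ) : 0 ≤ heatFlow p r f s j :=
  poissonAvg_nonneg hs fun n => hp.stepIter_nonneg hf n j

theorem heatFlow_mul_exp_le (hp : IsSymmStep p r) {f : ℤ → ℝ} (h0 : ∀ j, 0 ≤ f j)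
    {l : ℝ} (hf : ∀ j : ℤ, f j * Real.exp (l * j) ≤ 1) {s : ℝ} (hs : 0 ≤ s) (j : ℤ) :
    heatFlow p r f s j * Real.exp (l * j) ≤ Real.exp (s * (stepMgf p r l - 1)) := by
  rw [← poissonAvg_pow, ← le_div_iff₀ (Real.exp_pos _), div_eq_mul_inv, mul_comm, heatFlow]
  have hM : 0 ≤ stepMgf p r l := zero_le_one.trans (hp.one_le_stepMgf l)
  have h2 : ∀ n, stepIter p r f n j ≤ (Real.exp (l * j))⁻¹ * stepMgf p r l ^ n := fun n => by
    rw [mul_comm, ← div_eq_mul_inv, le_div_iff₀ (Real.exp_pos _)]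
    exact hp.stepIter_mul_exp_le hf n j
  refine (poissonAvg_mono hs
    (fun n => (abs_of_nonneg (hp.stepIter_nonneg h0 n j)).trans_le (h2 n))
    (fun n => (abs_of_nonneg (by positivity)).le) h2).trans (le_of_eq ?_)
  have := poissonAvg_sum {()} (fun _ => (Real.exp (l * j))⁻¹) (a := fun _ n => stepMgf p r l ^ n)
    (B := 1) (R := stepMgf p r l) (fun _ n => by rw [abs_of_nonneg (by positivity), one_mul]) s
  simpa using this

theorem heatFlow_le_one (hp : IsSymmStep p r) {f : ℤ → ℝ} (h0 : ∀ j, 0 ≤ f j)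
    (h1 : ∀ j, f j ≤ 1) {s : ℝ} (hs : 0 ≤ s) (j : ℤ) : heatFlow p r f s j ≤ 1 := by
  have h := hp.heatFlow_mul_exp_le h0 (l := 0) (by simpa using h1) hs j
  simpa [stepMgf, hp.sum_eq_one] using h

theorem hasDerivAt_heatFlow (hp : IsSymmStep p r) {f : ℤ → ℝ} (h0 : ∀ j, 0 ≤ f j)
    (h1 : ∀ j, f j ≤ 1) (s : ℝ) (j : ℤ) :
    HasDerivAt (fun s => heatFlow p r f s j)
      (stepSum p r (heatFlow p r f s) j - heatFlow p r f s j) s := by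
  refine (hasDerivAt_poissonAvg (fun n => hp.abs_stepIter_le_one h0 h1 n j) s).congr_deriv ?_
  congr 1
  simp only [stepIter_succ]
  exact poissonAvg_sum _ p (a := fun i n => stepIter p r f n (j + i)) (B := 1) (R := 1)
    (fun i n => by simpa using hp.abs_stepIter_le_one h0 h1 n (j + i)) s

theorem convPow_succ (hp : IsSymmStep p r) (n : ℕ) (x : ℤ) :
    convPow p (n + 1) x = ∑ i ∈ Finset.Icc (-(r : ℤ)) r, p i * convPow p n (x - i) := by
  rw [convPow, ← hp.tsum_eq_sum, ← (Equiv.subLeft x).tsum_eq]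
  exact tsum_congr fun i => by simp [mul_comm]

theorem convPow_nonneg (hp : IsSymmStep p r) (n : ℕ) (x : ℤ) : 0 ≤ convPow p n x := by
  induction n generalizing x with
  | zero => simp only [convPow]; split_ifs <;> norm_num
  | succ n ih =>
    rw [hp.convPow_succ]
    exact Finset.sum_nonneg fun i _ => mul_nonneg (hp.nonneg i) (ih _)

theorem hasSum_convPow_mul (hp : IsSymmStep p r) (f : ℤ → ℝ) (n : ℕ) (k : ℤ) :
    HasSum (fun y => convPow p n (y - k) * f y) (stepIter p r f n k) := by
  induction n generalizing k with
  | zero =>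
    rw [stepIter_zero]
    convert hasSum_ite_eq k (f k) using 2 with y
    simp only [convPow, sub_eq_zero]
    split_ifs with h <;> simp [h]
  | succ n ih =>
    rw [stepIter_succ]
    refine (hasSum_sum fun i _ => (ih (k + i)).mul_left (p i)).congr_fun fun y => ?_
    rw [hp.convPow_succ, Finset.sum_mul]
    exact Finset.sum_congr rfl fun i _ => by rw [sub_sub, mul_assoc]

theorem oneP_eq_heatFlow (hp : IsSymmStep p r) {f : ℤ → ℝ} (h0 : ∀ j, 0 ≤ f j)
    (h1 : ∀ j, f j ≤ 1) {s : ℝ} (hs : 0 ≤ s) (k : ℤ) : oneP p f s k = heatFlow p r f s k := by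
  set F : ℕ → ℤ → ℝ := fun n y =>
    (Real.exp (-s) * s ^ n / n.factorial) * (convPow p n (y - k) * f y) with hF
  have hsumF : ∀ n, HasSum (F n) ((Real.exp (-s) * s ^ n / n.factorial) * stepIter p r f n k) :=
    fun n => (hp.hasSum_convPow_mul f n k).mul_left _
  have hs2 : Summable (Function.uncurry F) := by
    rw [summable_prod_of_nonneg]
    · refine ⟨fun n => (hsumF n).summable, ?_⟩
      refine (summable_poisson_mul (a := fun n => stepIter p r f n k) (B := 1) (R := 1)
        (fun n => by simpa using hp.abs_stepIter_le_one h0 h1 n k) s).congr fun n => ?_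
      exact (hsumF n).tsum_eq.symm
    · rintro ⟨n, y⟩
      exact mul_nonneg (by positivity) (mul_nonneg (hp.convPow_nonneg n _) (h0 y))
  have h2 : oneP p f s k = ∑' y, ∑' n, F n y := by
    refine tsum_congr fun y => ?_
    rw [ctPMF, ← tsum_mul_right]
    exact tsum_congr fun n => by simp only [hF]; ring
  rw [h2, hs2.tsum_comm, heatFlow, poissonAvg]
  exact tsum_congr fun n => (hsumF n).tsum_eq

end IsSymmStep

/-- The full step profile `1_{j ≤ 0}`. -/
noncomputable def fullStep (k : ℤ) : ℝ := if k ≤ 0 then 1 else 0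

/-- The point mass at `0`. -/
noncomputable def pointMass (k : ℤ) : ℝ := if k = 0 then 1 else 0

theorem fullStep_nonneg (k : ℤ) : 0 ≤ fullStep k := by
  unfold fullStep; split_ifs <;> norm_num

theorem fullStep_le_one (k : ℤ) : fullStep k ≤ 1 := by
  unfold fullStep; split_ifs <;> norm_num

theorem pointMass_nonneg (k : ℤ) : 0 ≤ pointMass k := by
  unfold pointMass; split_ifs <;> norm_num

theorem pointMass_le_one (k : ℤ) : pointMass k ≤ 1 := by
  unfold pointMass; split_ifs <;> norm_num

theorem fullStep_sub_succ (k : ℤ) : fullStep k - fullStep (k + 1) = pointMass k := by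
  unfold fullStep pointMass
  split_ifs <;> first | omega | norm_num

theorem fullStep_mul_exp_le {l : ℝ} (hl : 0 ≤ l) (j : ℤ) :
    fullStep j * Real.exp (l * j) ≤ 1 := by
  unfold fullStep
  split_ifs with h
  · rw [one_mul, Real.exp_le_one_iff]
    exact mul_nonpos_of_nonneg_of_nonpos hl (by exact_mod_cast h)
  · simp

theorem heatFlow_zero (p : ℤ → ℝ) (r : ℕ) (f : ℤ → ℝ) (j : ℤ) : heatFlow p r f 0 j = f j := by
  rw [heatFlow, poissonAvg_zero, stepIter_zero]

theorem stepIter_fullStep_sub (p : ℤ → ℝ) (r n : ℕ) (j : ℤ) :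
    stepIter p r fullStep n j - stepIter p r fullStep n (j + 1) = stepIter p r pointMass n j := by
  induction n generalizing j with
  | zero => simpa [stepIter_zero] using fullStep_sub_succ j
  | succ n ih =>
    simp only [stepIter_succ]
    rw [← Finset.sum_sub_distrib]
    refine Finset.sum_congr rfl fun i _ => ?_
    rw [← mul_sub, ← ih, add_right_comm]

namespace IsSymmStep

variable {p : ℤ → ℝ} {r : ℕ}

theorem heatFlow_fullStep_sub (hp : IsSymmStep p r) (s : ℝ) (j : ℤ) :
    heatFlow p r fullStep s j - heatFlow p r fullStep s (j + 1) = heatFlow p r pointMass s j := by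
  have h := fun k : ℤ => summable_poisson_mul (B := 1) (R := 1)
    (a := fun n => stepIter p r fullStep n k)
    (fun n => by simpa using hp.abs_stepIter_le_one fullStep_nonneg fullStep_le_one n k) s
  simp only [heatFlow, poissonAvg]
  rw [← (h j).tsum_sub (h (j + 1))]
  exact tsum_congr fun n => by rw [← stepIter_fullStep_sub]; ring

theorem antitone_heatFlow_fullStep (hp : IsSymmStep p r) {s : ℝ} (hs : 0 ≤ s) :
    Antitone (heatFlow p r fullStep s) := by
  refine antitone_int_of_succ_le fun j => ?_
  have h := hp.heatFlow_nonneg pointMass_nonneg hs j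
  rw [← hp.heatFlow_fullStep_sub] at h
  linarith

theorem hasSum_stepIter_pointMass (hp : IsSymmStep p r) (l : ℝ) (n : ℕ) :
    HasSum (fun j : ℤ => stepIter p r pointMass n j * Real.exp (l * j)) (stepMgf p r l ^ n) := by
  induction n with
  | zero =>
    rw [pow_zero]
    convert hasSum_ite_eq (0 : ℤ) (1 : ℝ) using 2 with j
    rw [stepIter_zero, pointMass]
    split_ifs with h <;> simp [h]
  | succ n ih =>
    rw [pow_succ']
    nth_rw 1 [← hp.stepMgf_neg]
    rw [stepMgf, Finset.sum_mul]
    refine (hasSum_sum fun i _ => (((Equiv.addRight i).hasSum_iff.2 ih).mul_left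
      (p i * Real.exp (-l * i)))).congr_fun fun j => ?_
    rw [stepIter_succ, Finset.sum_mul]
    refine Finset.sum_congr rfl fun i _ => ?_
    have : Real.exp (l * j) = Real.exp (-l * i) * Real.exp (l * (j + i : ℤ)) := by
      rw [← Real.exp_add]; push_cast; ring_nf
    simp only [Function.comp_apply, Equiv.coe_addRight]
    rw [this]; ring

theorem sum_heatFlow_pointMass_le (hp : IsSymmStep p r) (l : ℝ) {s : ℝ} (hs : 0 ≤ s)
    (A : Finset ℤ) :
    ∑ j ∈ A, heatFlow p r pointMass s j * Real.exp (l * j)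
      ≤ Real.exp (s * (stepMgf p r l - 1)) := by
  have hM : 0 ≤ stepMgf p r l := zero_le_one.trans (hp.one_le_stepMgf l)
  have h1 := poissonAvg_sum A (fun j : ℤ => Real.exp (l * j))
    (a := fun j n => stepIter p r pointMass n j) (B := 1) (R := 1)
    (fun j n => by simpa using hp.abs_stepIter_le_one pointMass_nonneg pointMass_le_one n j) s
  have h2 : ∑ j ∈ A, heatFlow p r pointMass s j * Real.exp (l * j)
      = poissonAvg (fun n => ∑ j ∈ A, Real.exp (l * j) * stepIter p r pointMass n j) s := by
    rw [h1]
    exact Finset.sum_congr rfl fun j _ => mul_comm _ _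
  have h0 : ∀ n j, 0 ≤ Real.exp (l * (j : ℤ)) * stepIter p r pointMass n j := fun n j =>
    mul_nonneg (Real.exp_pos _).le (hp.stepIter_nonneg pointMass_nonneg n j)
  have h3 : ∀ n, ∑ j ∈ A, Real.exp (l * j) * stepIter p r pointMass n j ≤ stepMgf p r l ^ n := by
    intro n
    have h4 := hp.hasSum_stepIter_pointMass l n
    simp only [mul_comm (stepIter p r pointMass n _)] at h4
    exact sum_le_hasSum A (fun j _ => h0 n j) h4
  rw [h2, ← poissonAvg_pow]
  exact poissonAvg_mono (A := 1) (B := 1) (R := stepMgf p r l) (S := stepMgf p r l) hs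
    (fun n => by
      rw [abs_of_nonneg (Finset.sum_nonneg fun j _ => h0 n j), one_mul]; exact h3 n)
    (fun n => by rw [abs_of_nonneg (by positivity), one_mul]) h3

/-- The Fourier symbol of the step distribution tilted by `exp (-l i)`. -/
noncomputable def _root_.tiltedSymbol (p : ℤ → ℝ) (r : ℕ) (l u : ℝ) : ℂ :=
  ∑ i ∈ Finset.Icc (-(r : ℤ)) r,
    ((p i * Real.exp (-l * i) : ℝ) : ℂ) * Complex.exp (((u * i : ℝ) : ℂ) * Complex.I)

theorem _root_.continuous_tiltedSymbol (p : ℤ → ℝ) (r : ℕ) (l : ℝ) :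
    Continuous (tiltedSymbol p r l) := by
  unfold tiltedSymbol
  fun_prop

theorem norm_tiltedSymbol_le (hp : IsSymmStep p r) (l u : ℝ) :
    ‖tiltedSymbol p r l u‖ ≤ stepMgf p r l := by
  rw [← hp.stepMgf_neg, stepMgf, tiltedSymbol]
  refine (norm_sum_le _ _).trans (Finset.sum_le_sum fun i _ => ?_)
  rw [norm_mul, Complex.norm_exp_ofReal_mul_I, mul_one, Complex.norm_real, Real.norm_eq_abs,
    abs_of_nonneg (mul_nonneg (hp.nonneg i) (Real.exp_pos _).le)]

theorem re_tiltedSymbol_le (hp : IsSymmStep p r) {l : ℝ} (hl : 0 ≤ l) {m : ℤ} (hm : 0 ≤ m)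
    (hmr : m ≤ r) (u : ℝ) :
    (tiltedSymbol p r l u).re ≤ stepMgf p r l - p m * (1 - Real.cos (u * m)) := by
  have h1 : (tiltedSymbol p r l u).re
      = ∑ i ∈ Finset.Icc (-(r : ℤ)) r, p i * Real.exp (-l * i) * Real.cos (u * i) := by
    rw [tiltedSymbol, Complex.re_sum]
    refine Finset.sum_congr rfl fun i _ => ?_
    rw [Complex.re_ofReal_mul, Complex.exp_ofReal_mul_I_re]
  have h2 : stepMgf p r l - (tiltedSymbol p r l u).re
      = ∑ i ∈ Finset.Icc (-(r : ℤ)) r, p i * Real.exp (-l * i) * (1 - Real.cos (u * i)) := by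
    rw [h1, ← hp.stepMgf_neg, stepMgf, ← Finset.sum_sub_distrib]
    exact Finset.sum_congr rfl fun i _ => by ring
  have h3 : p (-m) * Real.exp (-l * (-m : ℤ)) * (1 - Real.cos (u * (-m : ℤ)))
      ≤ stepMgf p r l - (tiltedSymbol p r l u).re := by
    rw [h2]
    refine Finset.single_le_sum
      (f := fun i : ℤ => p i * Real.exp (-l * i) * (1 - Real.cos (u * i))) (fun i _ => ?_)
      (Finset.mem_Icc.2 (by omega))
    exact mul_nonneg (mul_nonneg (hp.nonneg i) (Real.exp_pos _).le)
      (sub_nonneg.2 (Real.cos_le_one _))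
  have h4 : p m * (1 - Real.cos (u * m))
      ≤ p (-m) * Real.exp (-l * (-m : ℤ)) * (1 - Real.cos (u * (-m : ℤ))) := by
    push_cast
    rw [hp.symm, mul_neg, mul_neg, Real.cos_neg]
    refine mul_le_mul_of_nonneg_right ?_ (sub_nonneg.2 (Real.cos_le_one _))
    refine le_mul_of_one_le_right (hp.nonneg m) (Real.one_le_exp ?_)
    have : (0 : ℝ) ≤ m := by exact_mod_cast hm
    nlinarith
  linarith

theorem _root_.integral_exp_int_mul_I (j : ℤ) :
    ∫ u in (-Real.pi)..Real.pi, Complex.exp (((u * j : ℝ) : ℂ) * Complex.I)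
      = 2 * Real.pi * (pointMass j : ℂ) := by
  rcases eq_or_ne j 0 with rfl | hj
  · simp [pointMass, two_mul]
  · have hc : (j : ℂ) * Complex.I ≠ 0 := by simp [hj]
    have h1 : ∀ u : ℝ, Complex.exp (((u * j : ℝ) : ℂ) * Complex.I)
        = Complex.exp ((j : ℂ) * Complex.I * u) := fun u => by push_cast; ring_nf
    simp_rw [h1]
    rw [integral_exp_mul_complex hc]
    have h2 : Complex.exp ((j : ℂ) * Complex.I * (Real.pi : ℝ))
        = Complex.exp ((j : ℂ) * Complex.I * ((-Real.pi : ℝ) : ℂ)) := by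
      rw [Complex.exp_eq_exp_iff_exists_int]
      exact ⟨j, by push_cast; ring⟩
    rw [h2]
    simp [pointMass, hj]

theorem stepIter_pointMass_eq_integral (p : ℤ → ℝ) (r : ℕ) (l : ℝ) (n : ℕ) (j : ℤ) :
    2 * Real.pi * ((stepIter p r pointMass n j * Real.exp (l * j) : ℝ) : ℂ)
      = ∫ u in (-Real.pi)..Real.pi,
          Complex.exp (((u * j : ℝ) : ℂ) * Complex.I) * tiltedSymbol p r l u ^ n := by
  induction n generalizing j with
  | zero =>
    simp only [pow_zero, mul_one]
    rw [integral_exp_int_mul_I, stepIter_zero]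
    rcases eq_or_ne j 0 with rfl | hj
    · simp
    · simp [pointMass, hj]
  | succ n ih =>
    have hc := continuous_tiltedSymbol p r l
    have h1 : ∀ u : ℝ, Complex.exp (((u * j : ℝ) : ℂ) * Complex.I) * tiltedSymbol p r l u ^ (n + 1)
        = ∑ i ∈ Finset.Icc (-(r : ℤ)) r, ((p i * Real.exp (-l * i) : ℝ) : ℂ) *
          (Complex.exp (((u * (j + i : ℤ) : ℝ) : ℂ) * Complex.I) * tiltedSymbol p r l u ^ n) := by
      intro u
      rw [pow_succ, ← mul_assoc]
      conv_lhs => rw [tiltedSymbol]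
      rw [Finset.mul_sum]
      refine Finset.sum_congr rfl fun i _ => ?_
      have : Complex.exp (((u * (j + i : ℤ) : ℝ) : ℂ) * Complex.I)
          = Complex.exp (((u * j : ℝ) : ℂ) * Complex.I)
            * Complex.exp (((u * i : ℝ) : ℂ) * Complex.I) := by
        rw [← Complex.exp_add]; push_cast; ring_nf
      rw [this]; change _ * (tiltedSymbol p r l u ^ n) * _ = _; ring
    simp_rw [h1]
    rw [intervalIntegral.integral_finsetSum]
    · simp_rw [intervalIntegral.integral_const_mul, ← ih]
      rw [stepIter_succ, Finset.sum_mul]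
      push_cast
      rw [Finset.mul_sum]
      refine Finset.sum_congr rfl fun i _ => ?_
      have : Complex.exp ((l : ℂ) * j) = Complex.exp (-l * i) * Complex.exp (l * (j + i)) := by
        rw [← Complex.exp_add]; ring_nf
      rw [this]; ring
    · intro i _
      exact Continuous.intervalIntegrable (by fun_prop) _ _

end IsSymmStep

theorem integral_exp_cos_le {b : ℝ} (hb : 0 < b) {m : ℤ} (hm : 0 < m) :
    ∫ u in (-Real.pi)..Real.pi, Real.exp (-b * (1 - Real.cos (u * m)))
      ≤ √(Real.pi / (b * (2 / Real.pi ^ 2))) := by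
  set f : ℝ → ℝ := fun v => Real.exp (-b * (1 - Real.cos v)) with hf
  have hfc : Continuous f := by fun_prop
  have hper : Function.Periodic f (2 * Real.pi) := fun v => by simp [hf]
  have hm' : (m : ℝ) ≠ 0 := by exact_mod_cast hm.ne'
  have h1 : ∫ u in (-Real.pi)..Real.pi, f (u * m) = ∫ v in (-Real.pi)..Real.pi, f v := by
    rw [intervalIntegral.integral_comp_mul_right _ hm']
    have h2 := hper.intervalIntegral_add_zsmul_eq m (-Real.pi * m)
      (fun _ _ => hfc.intervalIntegrable _ _)
    have h3 := hper.intervalIntegral_add_eq (-Real.pi * m) (-Real.pi)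
    have e1 : -Real.pi * m + m • (2 * Real.pi) = Real.pi * m := by
      rw [zsmul_eq_mul]; ring
    have e2 : -Real.pi + 2 * Real.pi = Real.pi := by ring
    rw [e1] at h2
    rw [e2] at h3
    rw [h2, h3, zsmul_eq_mul, smul_eq_mul, inv_mul_cancel_left₀ hm']
  rw [h1, ← integral_gaussian, intervalIntegral.integral_of_le (by linarith [Real.pi_pos])]
  have hb' : 0 < b * (2 / Real.pi ^ 2) := by positivity
  have hint := integrable_exp_neg_mul_sq hb'
  refine (setIntegral_mono_on (hfc.integrableOn_Ioc) hint.integrableOn measurableSet_Ioc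
    fun v hv => ?_).trans
    (setIntegral_le_integral hint (Eventually.of_forall fun v => (Real.exp_pos _).le))
  have hc := Real.cos_le_one_sub_mul_cos_sq (x := v) (abs_le.2 ⟨hv.1.le, hv.2⟩)
  refine Real.exp_le_exp.2 ?_
  nlinarith

namespace IsSymmStep

variable {p : ℤ → ℝ} {r : ℕ}

theorem hasSum_poisson_tiltedSymbol (l s u : ℝ) :
    HasSum (fun n : ℕ => ((Real.exp (-s) * s ^ n / n.factorial : ℝ) : ℂ) * tiltedSymbol p r l u ^ n)
      (Complex.exp (s * (tiltedSymbol p r l u - 1))) := by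
  have h := (NormedSpace.expSeries_div_hasSum_exp ((s : ℂ) * tiltedSymbol p r l u)).mul_left
    (Complex.exp (-s))
  rw [← Complex.exp_eq_exp_ℂ, ← Complex.exp_add] at h
  rw [show (s : ℂ) * (tiltedSymbol p r l u - 1) = -s + s * tiltedSymbol p r l u by ring]
  refine h.congr_fun fun n => ?_
  push_cast
  rw [mul_pow]
  ring

theorem heatFlow_pointMass_eq_integral (hp : IsSymmStep p r) (l : ℝ) {s : ℝ} (hs : 0 ≤ s) (j : ℤ) :
    2 * Real.pi * ((heatFlow p r pointMass s j * Real.exp (l * j) : ℝ) : ℂ)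
      = ∫ u in (-Real.pi)..Real.pi, Complex.exp (((u * j : ℝ) : ℂ) * Complex.I)
          * Complex.exp (s * (tiltedSymbol p r l u - 1)) := by
  have hc := continuous_tiltedSymbol p r l
  have hM : 0 ≤ stepMgf p r l := zero_le_one.trans (hp.one_le_stepMgf l)
  have hw : ∀ n : ℕ, 0 ≤ Real.exp (-s) * s ^ n / n.factorial := fun n => by positivity
  have h1 : HasSum (fun n : ℕ => ∫ u in (-Real.pi)..Real.pi,
      ((Real.exp (-s) * s ^ n / n.factorial : ℝ) : ℂ) *
        (Complex.exp (((u * j : ℝ) : ℂ) * Complex.I) * tiltedSymbol p r l u ^ n))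
      (∫ u in (-Real.pi)..Real.pi, Complex.exp (((u * j : ℝ) : ℂ) * Complex.I)
          * Complex.exp (s * (tiltedSymbol p r l u - 1))) := by
    refine intervalIntegral.hasSum_integral_of_dominated_convergence
      (fun n _ => (Real.exp (-s) * s ^ n / n.factorial) * stepMgf p r l ^ n) ?_ ?_ ?_ ?_ ?_
    · exact fun n => Continuous.aestronglyMeasurable (by fun_prop)
    · refine fun n => Eventually.of_forall fun u _ => ?_
      rw [norm_mul, norm_mul, Complex.norm_exp_ofReal_mul_I, one_mul, Complex.norm_real,
        Real.norm_eq_abs, abs_of_nonneg (hw n), norm_pow]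
      exact mul_le_mul_of_nonneg_left
        (pow_le_pow_left₀ (norm_nonneg _) (hp.norm_tiltedSymbol_le l u) n) (hw n)
    · exact Eventually.of_forall fun u _ => summable_poisson_mul (B := 1) (R := stepMgf p r l)
        (fun n => by rw [abs_of_nonneg (by positivity), one_mul]) s
    · exact intervalIntegrable_const
    · refine Eventually.of_forall fun u _ => ?_
      refine ((hasSum_poisson_tiltedSymbol (p := p) (r := r) l s u).mul_left
        (Complex.exp (((u * j : ℝ) : ℂ) * Complex.I))).congr_fun fun n => ?_
      ring
  simp_rw [intervalIntegral.integral_const_mul, ← stepIter_pointMass_eq_integral] at h1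
  rw [← h1.tsum_eq, heatFlow, poissonAvg, ← tsum_mul_right, Complex.ofReal_tsum, ← tsum_mul_left]
  refine tsum_congr fun n => ?_
  push_cast
  ring

theorem heatFlow_pointMass_mul_exp_le (hp : IsSymmStep p r) {l : ℝ} (hl : 0 ≤ l) {m : ℤ}
    (hm : 0 < m) (hpm : 0 < p m) {s : ℝ} (hs : 0 < s) (j : ℤ) :
    heatFlow p r pointMass s j * Real.exp (l * j)
      ≤ Real.exp (s * (stepMgf p r l - 1)) * (√(Real.pi ^ 3 / (2 * p m)) / √s) := by
  have hmr : m ≤ r := by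
    by_contra hc
    have := hp.support m (by rw [abs_of_pos hm]; omega)
    linarith
  have h1 := congrArg norm (hp.heatFlow_pointMass_eq_integral l hs.le j)
  have hG : 0 ≤ heatFlow p r pointMass s j * Real.exp (l * j) :=
    mul_nonneg (hp.heatFlow_nonneg pointMass_nonneg hs.le j) (Real.exp_pos _).le
  rw [norm_mul, Complex.norm_real, Real.norm_eq_abs, abs_of_nonneg hG] at h1
  have h2 : ‖(2 * Real.pi : ℂ)‖ = 2 * Real.pi := by
    rw [norm_mul, Complex.norm_real, Real.norm_eq_abs, abs_of_pos Real.pi_pos]; simp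
  rw [h2] at h1
  have hc := continuous_tiltedSymbol p r l
  have h3 : ‖∫ u in (-Real.pi)..Real.pi, Complex.exp (((u * j : ℝ) : ℂ) * Complex.I)
          * Complex.exp (s * (tiltedSymbol p r l u - 1))‖
      ≤ ∫ u in (-Real.pi)..Real.pi, Real.exp (s * (stepMgf p r l - 1)) *
          Real.exp (-(s * p m) * (1 - Real.cos (u * m))) := by
    refine intervalIntegral.norm_integral_le_of_norm_le (by linarith [Real.pi_pos])
      (Eventually.of_forall fun u _ => ?_) (Continuous.intervalIntegrable (by fun_prop) _ _)
    rw [norm_mul, Complex.norm_exp_ofReal_mul_I, one_mul, Complex.norm_exp, Complex.re_ofReal_mul,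
      Complex.sub_re, Complex.one_re, ← Real.exp_add]
    refine Real.exp_le_exp.2 ?_
    have := mul_le_mul_of_nonneg_left (hp.re_tiltedSymbol_le hl hm.le hmr u) hs.le
    linarith
  rw [intervalIntegral.integral_const_mul] at h3
  have h4 := integral_exp_cos_le (mul_pos hs hpm) hm
  have h5 : √(Real.pi / (s * p m * (2 / Real.pi ^ 2))) = √(Real.pi ^ 3 / (2 * p m)) / √s := by
    rw [← Real.sqrt_div (by positivity)]
    congr 1
    field_simp
  rw [h5] at h4
  have h6 := h3.trans (mul_le_mul_of_nonneg_left h4 (Real.exp_pos _).le)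
  rw [← h1] at h6
  have : 1 ≤ 2 * Real.pi := by linarith [Real.pi_gt_three]
  exact (le_mul_of_one_le_left hG this).trans h6

theorem abs_heatFlow_fullStep_sub_le (hp : IsSymmStep p r) {s : ℝ} (hs : 0 ≤ s) {j k : ℤ}
    (hjk : |k - j| ≤ r) :
    |heatFlow p r fullStep s j - heatFlow p r fullStep s k|
      ≤ ∑ a ∈ Finset.range (2 * r), heatFlow p r pointMass s (j - r + a) := by
  have h1 : ∑ a ∈ Finset.range (2 * r), heatFlow p r pointMass s (j - r + a)
      = heatFlow p r fullStep s (j - r) - heatFlow p r fullStep s (j + r) := by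
    have := Finset.sum_range_sub' (fun a : ℕ => heatFlow p r fullStep s (j - r + a)) (2 * r)
    simp only [Nat.cast_add, Nat.cast_one, ← add_assoc, hp.heatFlow_fullStep_sub] at this
    rw [this]
    congr 2
    · simp
    · push_cast; ring
  have hanti := hp.antitone_heatFlow_fullStep hs
  have hr : (0 : ℤ) ≤ r := Int.natCast_nonneg r
  obtain ⟨hl, hu⟩ := abs_le.1 hjk
  have a1 := hanti (show j - r ≤ j by omega)
  have a2 := hanti (show j ≤ j + r by omega)
  have a3 := hanti (show j - r ≤ k by omega)
  have a4 := hanti (show k ≤ j + r by omega)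
  rw [h1, abs_le]
  constructor <;> linarith

theorem exp_mul_sq_sub_le (hp : IsSymmStep p r) {l : ℝ} (hl : 0 ≤ l) {s B : ℝ} (hs : 0 ≤ s)
    (hB : ∀ j : ℤ, heatFlow p r pointMass s j * Real.exp (l * j) ≤ B) {j k : ℤ}
    (hjk : |k - j| ≤ r) :
    Real.exp (l * (j + k)) * (heatFlow p r fullStep s j - heatFlow p r fullStep s k) ^ 2
      ≤ Real.exp (3 * l * r) * (2 * r * B) * ∑ a ∈ Finset.range (2 * r),
        heatFlow p r pointMass s (j - r + a) * Real.exp (l * (j - r + a : ℤ)) := by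
  set D : ℤ → ℝ := heatFlow p r pointMass s
  set G : ℤ → ℝ := fun i => D i * Real.exp (l * i) with hG
  have hD : ∀ i, 0 ≤ D i := hp.heatFlow_nonneg pointMass_nonneg hs
  have hG0 : ∀ i, 0 ≤ G i := fun i => mul_nonneg (hD i) (Real.exp_pos _).le
  have h1 := hp.abs_heatFlow_fullStep_sub_le hs hjk
  set x := |heatFlow p r fullStep s j - heatFlow p r fullStep s k| with hx
  set S := ∑ a ∈ Finset.range (2 * r), G (j - r + a) with hS
  have hS0 : 0 ≤ S := Finset.sum_nonneg fun a _ => hG0 _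
  have hSB : S ≤ 2 * r * B := by
    refine (Finset.sum_le_card_nsmul _ _ B fun a _ => hB _).trans (le_of_eq ?_)
    rw [Finset.card_range, nsmul_eq_mul]; push_cast; ring
  have h2 : Real.exp (l * (j - r)) * x ≤ S := by
    refine (mul_le_mul_of_nonneg_left h1 (Real.exp_pos _).le).trans ?_
    rw [Finset.mul_sum]
    refine Finset.sum_le_sum fun a _ => ?_
    rw [hG, mul_comm]
    refine mul_le_mul_of_nonneg_left (Real.exp_le_exp.2 ?_) (hD _)
    push_cast
    exact mul_le_mul_of_nonneg_left (by linarith [Nat.cast_nonneg (α := ℝ) a]) hl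
  have h3 : Real.exp (l * (j + k)) ≤ Real.exp (3 * l * r) * Real.exp (l * (j - r)) ^ 2 := by
    rw [← Real.exp_nat_mul, ← Real.exp_add]
    refine Real.exp_le_exp.2 ?_
    have : (k : ℝ) - j ≤ r := by exact_mod_cast (abs_le.1 hjk).2
    push_cast
    nlinarith
  rw [← sq_abs, ← hx]
  calc Real.exp (l * (j + k)) * x ^ 2
      ≤ Real.exp (3 * l * r) * Real.exp (l * (j - r)) ^ 2 * x ^ 2 := by gcongr
    _ = Real.exp (3 * l * r) * (Real.exp (l * (j - r)) * x) ^ 2 := by ring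
    _ ≤ Real.exp (3 * l * r) * S ^ 2 := by gcongr
    _ = Real.exp (3 * l * r) * (S * S) := by ring
    _ ≤ Real.exp (3 * l * r) * ((2 * r * B) * S) := by gcongr
    _ = _ := by ring

theorem sum_shift_le_one (hp : IsSymmStep p r) (j : ℤ) (A : Finset ℤ) :
    ∑ k ∈ A, p (k - j) ≤ 1 := by
  have h : HasSum p 1 := by
    rw [← hp.sum_eq_one]
    refine hasSum_sum_of_ne_finset_zero fun i hi => hp.support i ?_
    by_contra hc
    exact hi (Finset.mem_Icc.2 (abs_le.1 (not_lt.1 hc)))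
  exact sum_le_hasSum A (fun k _ => hp.nonneg _) ((Equiv.subRight j).hasSum_iff.2 h)

/-- The weighted Dirichlet-form source term in the equation for the covariances decays like
`s ^ (-1/2)`, up to the exponential growth rate of the weight. -/
theorem tsum_source_le (hp : IsSymmStep p r) {m : ℤ} (hm : 0 < m) (hpm : 0 < p m) {l : ℝ}
    (hl : 0 ≤ l) (hl1 : l ≤ 1) {s : ℝ} (hs : 0 < s) :
    ∑' q : ℤ × ℤ, Real.exp (l * (q.1 + q.2)) * (p (q.2 - q.1) *
        (heatFlow p r fullStep s q.1 - heatFlow p r fullStep s q.2) ^ 2)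
      ≤ Real.exp (3 * r) * (2 * r) ^ 2 * √(Real.pi ^ 3 / (2 * p m)) *
        (Real.exp (2 * (stepMgf p r l - 1) * s) / √s) := by
  set E := Real.exp (s * (stepMgf p r l - 1)) with hE
  set B := E * (√(Real.pi ^ 3 / (2 * p m)) / √s) with hB
  set G : ℤ → ℝ := fun i => heatFlow p r pointMass s i * Real.exp (l * i) with hG
  have hB0 : 0 ≤ B := by positivity
  have hG0 : ∀ i, 0 ≤ G i := fun i =>
    mul_nonneg (hp.heatFlow_nonneg pointMass_nonneg hs.le i) (Real.exp_pos _).le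
  have hbound : ∀ j k : ℤ, Real.exp (l * (j + k)) * (p (k - j) *
        (heatFlow p r fullStep s j - heatFlow p r fullStep s k) ^ 2)
      ≤ p (k - j) * (Real.exp (3 * r) * (2 * r * B) *
          ∑ a ∈ Finset.range (2 * r), G (j - r + a)) := by
    intro j k
    rcases le_or_gt |k - j| (r : ℤ) with hjk | hjk
    · rw [mul_left_comm]
      refine mul_le_mul_of_nonneg_left ?_ (hp.nonneg _)
      refine (hp.exp_mul_sq_sub_le hl hs.le
        (fun j => hp.heatFlow_pointMass_mul_exp_le hl hm hpm hs j) hjk).trans ?_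
      refine mul_le_mul_of_nonneg_right (mul_le_mul_of_nonneg_right (Real.exp_le_exp.2 ?_)
        (by positivity)) (Finset.sum_nonneg fun a _ => hG0 _)
      have : (0 : ℝ) ≤ r := Nat.cast_nonneg r
      nlinarith
    · simp [hp.support _ hjk]
  have hfin : Real.exp (3 * r) * (2 * r) ^ 2 * √(Real.pi ^ 3 / (2 * p m)) *
        (Real.exp (2 * (stepMgf p r l - 1) * s) / √s)
      = Real.exp (3 * r) * (2 * r * B) * (2 * r * E) := by
    have : Real.exp (2 * (stepMgf p r l - 1) * s) = E * E := by
      rw [hE, ← Real.exp_add]; ring_nf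
    rw [this, hB]; ring
  rw [hfin]
  refine Real.tsum_le_of_sum_le (fun q => mul_nonneg (Real.exp_pos _).le
    (mul_nonneg (hp.nonneg _) (sq_nonneg _))) fun A => ?_
  have hsub : A ⊆ A.image Prod.fst ×ˢ A.image Prod.snd := fun q hq =>
    Finset.mem_product.2 ⟨Finset.mem_image_of_mem _ hq, Finset.mem_image_of_mem _ hq⟩
  have hH : ∀ j : ℤ, 0 ≤ Real.exp (3 * r) * (2 * r * B) *
      ∑ a ∈ Finset.range (2 * r), G (j - r + a) := fun j =>
    mul_nonneg (by positivity) (Finset.sum_nonneg fun a _ => hG0 _)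
  calc _ ≤ ∑ q ∈ A, p (q.2 - q.1) * (Real.exp (3 * r) * (2 * r * B) *
          ∑ a ∈ Finset.range (2 * r), G (q.1 - r + a)) :=
        Finset.sum_le_sum fun q _ => hbound q.1 q.2
    _ ≤ ∑ q ∈ A.image Prod.fst ×ˢ A.image Prod.snd, p (q.2 - q.1) * (Real.exp (3 * r) *
          (2 * r * B) * ∑ a ∈ Finset.range (2 * r), G (q.1 - r + a)) :=
        Finset.sum_le_sum_of_subset_of_nonneg hsub fun q _ _ =>
          mul_nonneg (hp.nonneg _) (hH _)
    _ ≤ ∑ j ∈ A.image Prod.fst, Real.exp (3 * r) *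
          (2 * r * B) * ∑ a ∈ Finset.range (2 * r), G (j - r + a) := by
        rw [Finset.sum_product]
        refine Finset.sum_le_sum fun j _ => ?_
        simp only
        rw [← Finset.sum_mul]
        exact mul_le_of_le_one_left (hH j) (hp.sum_shift_le_one j _)
    _ = Real.exp (3 * r) * (2 * r * B) *
          ∑ a ∈ Finset.range (2 * r), ∑ j ∈ A.image Prod.fst, G (j - r + a) := by
        rw [← Finset.mul_sum, Finset.sum_comm]
    _ ≤ _ := by
        refine mul_le_mul_of_nonneg_left ?_ (by positivity)
        refine (Finset.sum_le_card_nsmul _ _ E fun a _ => ?_).trans (le_of_eq ?_)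
        · have := hp.sum_heatFlow_pointMass_le l hs.le
            ((A.image Prod.fst).map (Equiv.addRight (-(r : ℤ) + a)).toEmbedding)
          rw [Finset.sum_map] at this
          refine le_trans (le_of_eq (Finset.sum_congr rfl fun j _ => ?_)) this
          simp only [hG, Equiv.coe_toEmbedding, Equiv.coe_addRight]
          rw [show j - (r : ℤ) + a = j + (-(r : ℤ) + a) by ring]
        · rw [Finset.card_range, nsmul_eq_mul]; push_cast; ring

end IsSymmStep

/-- `v` is a bounded solution, started from `0`, of the equation for the negated covariances
`ρ_s(j) ρ_s(k) - E[η_s(j) η_s(k)]` of the exclusion process from the full step, with the value `0`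
on the diagonal. -/
structure IsNegCovFlow (p : ℤ → ℝ) (r : ℕ) (v : ℝ → ℤ → ℤ → ℝ) : Prop where
  diag : ∀ s j, v s j j = 0
  init : ∀ j k, v 0 j k = 0
  lower : ∀ s, 0 ≤ s → ∀ j k, -1 ≤ v s j k
  upper : ∀ s, 0 ≤ s → ∀ j k, v s j k ≤ heatFlow p r fullStep s j * heatFlow p r fullStep s k
  deriv : ∀ j k, j ≠ k → ∀ s, 0 ≤ s → HasDerivWithinAt (fun s => v s j k)
    (stepSum p r (fun a => v s a k) j + stepSum p r (fun b => v s j b) k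
      - (2 - 2 * p (k - j)) * v s j k
      + p (k - j) * (heatFlow p r fullStep s j - heatFlow p r fullStep s k) ^ 2) (Set.Ici 0) s

namespace IsSymmStep

variable {p : ℤ → ℝ} {r : ℕ}

theorem le_one (hp : IsSymmStep p r) (i : ℤ) : p i ≤ 1 := by
  simpa using hp.sum_shift_le_one 0 {i}

theorem sum_eq_sum_off_add (hp : IsSymmStep p r) (F : ℤ → ℝ) (d : ℤ) :
    ∑ i ∈ Finset.Icc (-(r : ℤ)) r, p i * F i
      = ∑ i ∈ Finset.Icc (-(r : ℤ)) r, p i * (if i = d then 0 else F i) + p d * F d := by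
  have h1 : ∑ i ∈ Finset.Icc (-(r : ℤ)) r, p i * (if i = d then F i else 0) = p d * F d := by
    rw [← hp.tsum_eq_sum, tsum_eq_single d fun i hi => by simp [hi]]
    simp
  rw [← h1, ← Finset.sum_add_distrib]
  exact Finset.sum_congr rfl fun i _ => by split_ifs <;> simp

theorem twoGen_eq (hp : IsSymmStep p r) (f : ℤ → ℤ → ℝ) (j k : ℤ) :
    twoGen p f j k
      = ∑ i ∈ Finset.Icc (-(r : ℤ)) r, p i * (if i = k - j then 0 else f (j + i) k - f j k)
        + ∑ i ∈ Finset.Icc (-(r : ℤ)) r, p i * (if i = j - k then 0 else f j (k + i) - f j k) := by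
  rw [twoGen, ← hp.tsum_eq_sum, ← hp.tsum_eq_sum]
  congr 1
  · rw [← (Equiv.addLeft j).tsum_eq]
    refine tsum_congr fun i => ?_
    simp only [Equiv.coe_addLeft, add_sub_cancel_left]
    by_cases h : i = k - j
    · simp [h]
    · rw [if_neg h, if_pos (by omega)]
  · rw [← (Equiv.addLeft k).tsum_eq]
    refine tsum_congr fun i => ?_
    simp only [Equiv.coe_addLeft, add_sub_cancel_left]
    by_cases h : i = j - k
    · simp [h]
    · rw [if_neg h, if_pos (by omega)]

theorem stepSum_mul_sub_off (hp : IsSymmStep p r) (R H : ℤ → ℝ) (c : ℝ) (j k : ℤ) :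
    stepSum p r (fun a => if a = k then 0 else R a * c - H a) j
      = stepSum p r R j * c - p (k - j) * (R k * c)
        - ∑ i ∈ Finset.Icc (-(r : ℤ)) r, p i * (if i = k - j then 0 else H (j + i) - H j)
        - (1 - p (k - j)) * H j := by
  have h1 := hp.sum_eq_sum_off_add (fun i => R (j + i) * c) (k - j)
  have h2 := hp.sum_eq_sum_off_add (fun _ => H j) (k - j)
  rw [← Finset.sum_mul, hp.sum_eq_one, one_mul] at h2
  simp only [add_sub_cancel] at h1
  have h3 : stepSum p r R j * c = ∑ i ∈ Finset.Icc (-(r : ℤ)) r, p i * (R (j + i) * c) := by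
    rw [stepSum, Finset.sum_mul]
    exact Finset.sum_congr rfl fun i _ => by ring
  have h4 : stepSum p r (fun a => if a = k then 0 else R a * c - H a) j
      = ∑ i ∈ Finset.Icc (-(r : ℤ)) r, p i * (if i = k - j then 0 else R (j + i) * c)
        - ∑ i ∈ Finset.Icc (-(r : ℤ)) r, p i * (if i = k - j then 0 else H (j + i) - H j)
        - ∑ i ∈ Finset.Icc (-(r : ℤ)) r, p i * (if i = k - j then 0 else H j) := by
    rw [stepSum, ← Finset.sum_sub_distrib, ← Finset.sum_sub_distrib]
    refine Finset.sum_congr rfl fun i _ => ?_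
    by_cases h : i = k - j
    · simp [h]
    · rw [if_neg (by omega), if_neg h, if_neg h, if_neg h]; ring
  rw [h4, h3, h1]
  linarith

theorem isNegCovFlow (hp : IsSymmStep p r) {h : ℝ → ℤ → ℤ → ℝ}
    (h0 : ∀ j k : ℤ, j ≠ k → h 0 j k = fullStep j * fullStep k)
    (hbdd : ∀ (t : ℝ) (j k : ℤ), 0 ≤ h t j k ∧ h t j k ≤ 1)
    (hderiv : ∀ j k : ℤ, j ≠ k → ∀ t : ℝ, 0 ≤ t →
      HasDerivWithinAt (fun s => h s j k) (twoGen p (h t) j k) (Set.Ici 0) t) :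
    IsNegCovFlow p r fun s j k => if j = k then 0 else
      heatFlow p r fullStep s j * heatFlow p r fullStep s k - h s j k where
  diag s j := if_pos rfl
  init j k := by
    split_ifs with hjk
    · rfl
    · rw [h0 j k hjk, heatFlow_zero, heatFlow_zero, sub_self]
  lower s hs j k := by
    have h1 := mul_nonneg (hp.heatFlow_nonneg fullStep_nonneg hs j)
      (hp.heatFlow_nonneg fullStep_nonneg hs k)
    split_ifs
    · norm_num
    · linarith [(hbdd s j k).2]
  upper s hs j k := by
    have h1 := mul_nonneg (hp.heatFlow_nonneg fullStep_nonneg hs j)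
      (hp.heatFlow_nonneg fullStep_nonneg hs k)
    split_ifs
    · exact h1
    · linarith [(hbdd s j k).1]
  deriv j k hjk s hs := by
    simp only [if_neg hjk]
    have d := fun i => (hp.hasDerivAt_heatFlow fullStep_nonneg fullStep_le_one s i)
    refine (((d j).mul (d k)).hasDerivWithinAt.sub (hderiv j k hjk s hs)).congr_deriv ?_
    have e1 := hp.stepSum_mul_sub_off (heatFlow p r fullStep s) (fun a => h s a k)
      (heatFlow p r fullStep s k) j k
    have e2 := hp.stepSum_mul_sub_off (heatFlow p r fullStep s) (fun b => h s j b)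
      (heatFlow p r fullStep s j) k j
    have e3 : (fun b => if j = b then 0 else
        heatFlow p r fullStep s j * heatFlow p r fullStep s b - h s j b)
        = fun b => if b = j then 0 else
          heatFlow p r fullStep s b * heatFlow p r fullStep s j - h s j b := by
      funext b
      rw [mul_comm]
      simp only [eq_comm]
    have e4 : p (j - k) = p (k - j) := by rw [← hp.symm, neg_sub]
    rw [e3, e1, e2, hp.twoGen_eq, e4]
    ring

end IsSymmStep

namespace IsNegCovFlow

variable {p : ℤ → ℝ} {r : ℕ} {v : ℝ → ℤ → ℤ → ℝ}

theorem exp_mul_lower (hv : IsNegCovFlow p r v) (hp : IsSymmStep p r) (T : ℝ) (n : ℕ) :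
    ∀ s ∈ Set.Icc 0 T, ∀ j k,
      -(Real.exp (2 * T) * ((4 * s) ^ n / n.factorial)) ≤ Real.exp (2 * s) * v s j k := by
  induction n with
  | zero =>
    intro s hs j k
    have h1 := hv.lower s hs.1 j k
    have h2 : Real.exp (2 * s) ≤ Real.exp (2 * T) := Real.exp_le_exp.2 (by linarith [hs.2])
    have h3 := Real.exp_pos (2 * s)
    simp only [pow_zero, Nat.factorial_zero, Nat.cast_one, div_one, mul_one]
    nlinarith
  | succ n ih =>
    intro s hs j k
    have hT : 0 ≤ T := hs.1.trans hs.2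
    have hK : ∀ s, 0 ≤ s → 0 ≤ Real.exp (2 * T) * ((4 * s) ^ n / n.factorial) := fun s hs => by
      positivity
    rcases eq_or_ne j k with rfl | hjk
    · rw [hv.diag, mul_zero, neg_nonpos]
      have := hs.1
      positivity
    have hd : ∀ s, 0 ≤ s → HasDerivWithinAt
        (fun s => Real.exp (2 * s) * v s j k
          + Real.exp (2 * T) * ((4 * s) ^ (n + 1) / (n + 1).factorial))
        (Real.exp (2 * s) * (stepSum p r (fun a => v s a k) j + stepSum p r (fun b => v s j b) k
          + 2 * p (k - j) * v s j k
          + p (k - j) * (heatFlow p r fullStep s j - heatFlow p r fullStep s k) ^ 2)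
          + 4 * (Real.exp (2 * T) * ((4 * s) ^ n / n.factorial))) (Set.Ici 0) s := by
      intro s hs
      have d1 : HasDerivAt (fun s : ℝ => Real.exp (2 * s)) (Real.exp (2 * s) * 2) s := by
        simpa using ((hasDerivAt_id s).const_mul 2).exp
      have d2 : HasDerivAt (fun s : ℝ => (4 * s) ^ (n + 1) / (n + 1).factorial)
          (4 * ((4 * s) ^ n / n.factorial)) s := by
        refine ((((hasDerivAt_id s).const_mul 4).pow (n + 1)).div_const _).congr_deriv ?_
        rw [Nat.factorial_succ]
        push_cast
        simp only [id]
        field_simp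
      refine ((d1.hasDerivWithinAt.mul (hv.deriv j k hjk s hs)).add
        (d2.const_mul (Real.exp (2 * T))).hasDerivWithinAt).congr_deriv ?_
      ring
    have hpos : ∀ s ∈ Set.Icc 0 T,
        0 ≤ Real.exp (2 * s) * (stepSum p r (fun a => v s a k) j + stepSum p r (fun b => v s j b) k
          + 2 * p (k - j) * v s j k
          + p (k - j) * (heatFlow p r fullStep s j - heatFlow p r fullStep s k) ^ 2)
          + 4 * (Real.exp (2 * T) * ((4 * s) ^ n / n.factorial)) := by
      intro s hs
      set K := Real.exp (2 * T) * ((4 * s) ^ n / n.factorial) with hKdef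
      have hK0 : 0 ≤ K := hK s hs.1
      have hsum : ∀ f : ℤ → ℝ, (∀ a, -K ≤ Real.exp (2 * s) * f a) → ∀ i,
          -K ≤ Real.exp (2 * s) * stepSum p r f i := by
        intro f hf i
        rw [stepSum, Finset.mul_sum]
        calc -K = ∑ i ∈ Finset.Icc (-(r : ℤ)) r, p i * -K := by
              rw [← Finset.sum_mul, hp.sum_eq_one, one_mul]
          _ ≤ _ := Finset.sum_le_sum fun a _ => by
              rw [mul_left_comm]
              exact mul_le_mul_of_nonneg_left (hf _) (hp.nonneg a)
      have a1 := hsum (fun a => v s a k) (fun a => ih s hs a k) j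
      have a2 := hsum (fun b => v s j b) (fun b => ih s hs j b) k
      have a3 := mul_le_mul_of_nonneg_left (ih s hs j k) (hp.nonneg (k - j))
      have a4 := mul_le_mul_of_nonneg_right (hp.le_one (k - j)) hK0
      have a5 : 0 ≤ Real.exp (2 * s) * (p (k - j) *
          (heatFlow p r fullStep s j - heatFlow p r fullStep s k) ^ 2) :=
        mul_nonneg (Real.exp_pos _).le (mul_nonneg (hp.nonneg _) (sq_nonneg _))
      linarith
    have hmono := monotoneOn_of_deriv_nonneg (convex_Icc 0 T)
      (fun s hs => (hd s hs.1).continuousWithinAt.mono Set.Icc_subset_Ici_self)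
      (fun s hs => by
        rw [interior_Icc] at hs
        exact ((hd s hs.1.le).hasDerivAt (Ici_mem_nhds hs.1)).differentiableAt.differentiableWithinAt)
      (fun s hs => by
        rw [interior_Icc] at hs
        rw [((hd s hs.1.le).hasDerivAt (Ici_mem_nhds hs.1)).deriv]
        exact hpos s ⟨hs.1.le, hs.2.le⟩)
    have := hmono ⟨le_rfl, hT⟩ hs hs.1
    simp only [hv.init] at this
    simp at this
    linarith

theorem nonneg (hv : IsNegCovFlow p r v) (hp : IsSymmStep p r) {s : ℝ} (hs : 0 ≤ s) (j k : ℤ) :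
    0 ≤ v s j k := by
  have h1 := fun n => hv.exp_mul_lower hp s n s ⟨hs, le_rfl⟩ j k
  have h2 := ((FloorSemiring.tendsto_pow_div_factorial_atTop (4 * s)).const_mul
    (Real.exp (2 * s))).neg
  rw [mul_zero, neg_zero] at h2
  exact nonneg_of_mul_nonneg_right (le_of_tendsto' h2 h1) (Real.exp_pos _)

end IsNegCovFlow

theorem summable_exp_neg_mul_abs_int {l : ℝ} (hl : 0 < l) :
    Summable fun j : ℤ => Real.exp (-l * |(j : ℝ)|) := by
  have h : Summable fun n : ℕ => Real.exp (-l * n) := by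
    refine (summable_geometric_of_lt_one (Real.exp_pos (-l)).le
      (Real.exp_lt_one_iff.2 (by linarith))).congr fun n => ?_
    rw [← Real.exp_nat_mul, mul_comm]
  refine Summable.of_nat_of_neg ?_ ?_ <;> simpa using h

theorem summable_exp_neg_mul_abs_int_prod {l : ℝ} (hl : 0 < l) :
    Summable fun q : ℤ × ℤ => Real.exp (-l * |(q.1 : ℝ)|) * Real.exp (-l * |(q.2 : ℝ)|) :=
  (summable_exp_neg_mul_abs_int hl).mul_of_nonneg (summable_exp_neg_mul_abs_int hl)
    (fun _ => (Real.exp_pos _).le) fun _ => (Real.exp_pos _).le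

theorem exp_neg_mul_abs_le {l : ℝ} (hl : 0 ≤ l) {a b c : ℝ} (h : |b - a| ≤ c) :
    Real.exp (-l * |a|) ≤ Real.exp (l * c) * Real.exp (-l * |b|) := by
  rw [← Real.exp_add]
  refine Real.exp_le_exp.2 ?_
  have : |b| - |a| ≤ c := (abs_sub_abs_le_abs_sub b a).trans h
  nlinarith

/-- The two-particle exclusion generator conjugated by the weight `(j, k) ↦ exp (l (j + k))`. -/
noncomputable def tiltedGen (p : ℤ → ℝ) (r : ℕ) (l : ℝ) (W : ℤ × ℤ → ℝ) (q : ℤ × ℤ) : ℝ :=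
  if q.1 = q.2 then 0 else
    ∑ i ∈ Finset.Icc (-(r : ℤ)) r, p i * Real.exp (-l * i) * W (q.1 + i, q.2)
    + ∑ i ∈ Finset.Icc (-(r : ℤ)) r, p i * Real.exp (-l * i) * W (q.1, q.2 + i)
    - (2 - 2 * p (q.2 - q.1)) * W q

namespace IsSymmStep

variable {p : ℤ → ℝ} {r : ℕ}

theorem exp_mul_heatFlow_fullStep_le (hp : IsSymmStep p r) {l : ℝ} (hl : 0 ≤ l) {s T : ℝ}
    (hs : 0 ≤ s) (hsT : s ≤ T) (j : ℤ) :
    Real.exp (l * j) * heatFlow p r fullStep s j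
      ≤ Real.exp (T * (stepMgf p r (2 * l) - 1)) * Real.exp (-l * |(j : ℝ)|) := by
  have hM := hp.one_le_stepMgf (2 * l)
  rcases le_total 0 j with hj | hj
  · have hj' : (0 : ℝ) ≤ j := by exact_mod_cast hj
    have h1 := hp.heatFlow_mul_exp_le fullStep_nonneg
      (fullStep_mul_exp_le (show 0 ≤ 2 * l by linarith)) hs j
    have h2 : Real.exp (s * (stepMgf p r (2 * l) - 1)) ≤ Real.exp (T * (stepMgf p r (2 * l) - 1)) :=
      Real.exp_le_exp.2 (mul_le_mul_of_nonneg_right hsT (by linarith))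
    have h3 : Real.exp (l * j) = Real.exp (2 * l * j) * Real.exp (-l * |(j : ℝ)|) := by
      rw [abs_of_nonneg hj', ← Real.exp_add]; ring_nf
    rw [h3, mul_right_comm, mul_comm (Real.exp (2 * l * j))]
    exact mul_le_mul_of_nonneg_right (h1.trans h2) (Real.exp_pos _).le
  · have hj' : (j : ℝ) ≤ 0 := by exact_mod_cast hj
    rw [abs_of_nonpos hj', neg_mul_neg, mul_comm]
    refine mul_le_mul_of_nonneg_right ?_ (Real.exp_pos _).le
    exact (hp.heatFlow_le_one fullStep_nonneg fullStep_le_one hs j).trans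
      (Real.one_le_exp (mul_nonneg (hs.trans hsT) (by linarith)))

/-- Moving one coordinate by a tilted step, off the diagonal. -/
theorem hasSum_tilted_off (hp : IsSymmStep p r) (l : ℝ) {W : ℤ × ℤ → ℝ} (hW0 : ∀ q, 0 ≤ W q)
    (hW : Summable W) :
    Summable (fun q : ℤ × ℤ =>
        W q * (stepMgf p r l - p (q.1 - q.2) * Real.exp (-l * (q.1 - q.2 : ℤ)))) ∧
    HasSum (fun q : ℤ × ℤ => if q.1 = q.2 then 0 else
        ∑ i ∈ Finset.Icc (-(r : ℤ)) r, p i * Real.exp (-l * i) * W (q.1 + i, q.2))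
      (∑' q, W q * (stepMgf p r l - p (q.1 - q.2) * Real.exp (-l * (q.1 - q.2 : ℤ)))) := by
  set U : ℤ → ℤ × ℤ → ℝ := fun i q =>
    p i * Real.exp (-l * i) * (if i = q.1 - q.2 then 0 else W q) with hU
  have hUs : ∀ i, Summable (U i) := fun i => by
    refine Summable.mul_left _ (Summable.of_nonneg_of_le (fun q => ?_) (fun q => ?_) hW)
    · split_ifs
      exacts [le_rfl, hW0 q]
    · split_ifs
      exacts [hW0 q, le_rfl]
  have hUsum : ∀ q, ∑ i ∈ Finset.Icc (-(r : ℤ)) r, U i q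
      = W q * (stepMgf p r l - p (q.1 - q.2) * Real.exp (-l * (q.1 - q.2 : ℤ))) := by
    intro q
    have h1 := hp.sum_eq_sum_off_add (fun i => Real.exp (-l * i)) (q.1 - q.2)
    rw [← hp.stepMgf_neg, stepMgf, h1, add_sub_cancel_right, Finset.mul_sum]
    exact Finset.sum_congr rfl fun i _ => by simp only [hU]; split_ifs <;> ring
  have hs : HasSum (fun q => ∑ i ∈ Finset.Icc (-(r : ℤ)) r, U i q)
      (∑ i ∈ Finset.Icc (-(r : ℤ)) r, ∑' q, U i q) := hasSum_sum fun i _ => (hUs i).hasSum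
  simp only [hUsum] at hs
  refine ⟨hs.summable, ?_⟩
  rw [hs.tsum_eq]
  refine (hasSum_sum fun i _ => (((Equiv.addRight i).prodCongr (Equiv.refl ℤ)).hasSum_iff.2
    (hUs i).hasSum)).congr_fun ?_
  rintro ⟨a, b⟩
  simp only [hU, Function.comp_apply, Equiv.prodCongr_apply, Prod.map_apply, Equiv.coe_addRight,
    Equiv.coe_refl, id]
  by_cases hq : a = b
  · rw [if_pos hq]
    exact (Finset.sum_eq_zero fun i _ => by rw [if_pos (by omega), mul_zero]).symm
  · rw [if_neg hq]
    exact Finset.sum_congr rfl fun i _ => by rw [if_neg (by omega)]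

/-- The exponential weight is a supersolution for the adjoint two-particle exclusion dynamics. -/
theorem tsum_tiltedGen_le (hp : IsSymmStep p r) (l : ℝ) {W : ℤ × ℤ → ℝ}
    (hW0 : ∀ q, 0 ≤ W q) (hWd : ∀ j, W (j, j) = 0) (hW : Summable W) :
    Summable (tiltedGen p r l W) ∧
    ∑' q, tiltedGen p r l W q ≤ 2 * (stepMgf p r l - 1) * ∑' q, W q := by
  set c : ℤ × ℤ → ℝ := fun q =>
    stepMgf p r l - p (q.1 - q.2) * Real.exp (-l * (q.1 - q.2 : ℤ)) with hc
  obtain ⟨s1, t1⟩ := hp.hasSum_tilted_off l hW0 hW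
  obtain ⟨s2, t2⟩ := hp.hasSum_tilted_off l (W := W ∘ Prod.swap) (fun q => hW0 _)
    ((Equiv.prodComm ℤ ℤ).summable_iff.2 hW)
  have s2' : Summable fun q => W q * c q.swap := (Equiv.prodComm ℤ ℤ).summable_iff.2 s2
  have e2 : ∑' q : ℤ × ℤ, (W ∘ Prod.swap) q * c q = ∑' q, W q * c q.swap :=
    (Equiv.prodComm ℤ ℤ).tsum_eq fun q => W q * c q.swap
  have t2' := (Equiv.prodComm ℤ ℤ).hasSum_iff.2 t2
  change HasSum _ (∑' q : ℤ × ℤ, (W ∘ Prod.swap) q * c q) at t2'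
  rw [e2] at t2'
  have s3 : Summable fun q : ℤ × ℤ => if q.1 = q.2 then 0 else (2 - 2 * p (q.2 - q.1)) * W q := by
    refine Summable.of_nonneg_of_le (fun q => ?_) (fun q => ?_) (hW.mul_left 2)
    · split_ifs
      · exact le_rfl
      · exact mul_nonneg (by linarith [hp.le_one (q.2 - q.1)]) (hW0 q)
    · split_ifs
      · exact mul_nonneg zero_le_two (hW0 q)
      · exact mul_le_mul_of_nonneg_right (by linarith [hp.nonneg (q.2 - q.1)]) (hW0 q)
  have t : HasSum (tiltedGen p r l W) _ := ((t1.add t2').sub s3.hasSum).congr_fun fun q => by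
    obtain ⟨a, b⟩ := q
    by_cases hq : a = b
    · simp [tiltedGen, hq]
    · simp [tiltedGen, hq, Ne.symm hq]
  refine ⟨t.summable, ?_⟩
  rw [t.tsum_eq, ← s1.tsum_add s2', ← (s1.add s2').tsum_sub s3, ← tsum_mul_left]
  refine Summable.tsum_le_tsum (fun q => ?_) ((s1.add s2').sub s3) (hW.mul_left _)
  obtain ⟨a, b⟩ := q
  by_cases hq : a = b
  · simp [hq, hWd]
  · simp only [hc, Prod.swap_prod_mk, if_neg hq]
    have h1 : p (b - a) = p (a - b) := by rw [← hp.symm, neg_sub]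
    have h2 : Real.exp (-l * (b - a : ℤ)) = Real.exp (l * (a - b : ℤ)) := by
      push_cast; ring_nf
    have h3 : 2 ≤ Real.exp (-l * (a - b : ℤ)) + Real.exp (l * (a - b : ℤ)) := by
      have := Real.add_one_le_exp (-l * (a - b : ℤ))
      have := Real.add_one_le_exp (l * (a - b : ℤ))
      linarith
    rw [h1, h2]
    nlinarith [mul_nonneg (mul_nonneg (hW0 (a, b)) (hp.nonneg (a - b))) (sub_nonneg.2 h3)]

end IsSymmStep

/-- The weight `(j, k) ↦ exp (l (j + k))` times a function of two particles. -/
noncomputable def tilt (l : ℝ) (f : ℤ → ℤ → ℝ) (q : ℤ × ℤ) : ℝ :=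
  Real.exp (l * (q.1 + q.2)) * f q.1 q.2

/-- The weighted source term in the evolution of the two-point covariances. -/
noncomputable def tiltedSource (p : ℤ → ℝ) (r : ℕ) (l s : ℝ) (q : ℤ × ℤ) : ℝ :=
  Real.exp (l * (q.1 + q.2)) * (p (q.2 - q.1) *
    (heatFlow p r fullStep s q.1 - heatFlow p r fullStep s q.2) ^ 2)

/-- A summable majorant on `ℤ × ℤ`. -/
noncomputable def expMajorant (l : ℝ) (q : ℤ × ℤ) : ℝ :=
  Real.exp (-l * |(q.1 : ℝ)|) * Real.exp (-l * |(q.2 : ℝ)|)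

theorem expMajorant_nonneg (l : ℝ) (q : ℤ × ℤ) : 0 ≤ expMajorant l q := by
  unfold expMajorant; positivity

theorem expMajorant_add_fst_le {l : ℝ} (hl : 0 ≤ l) {r : ℕ} {i : ℤ}
    (hi : i ∈ Finset.Icc (-(r : ℤ)) r) (a b : ℤ) :
    expMajorant l (a + i, b) ≤ Real.exp (l * r) * expMajorant l (a, b) := by
  have h : |(a : ℝ) - (a + i : ℤ)| ≤ r := by
    have := abs_le.2 (Finset.mem_Icc.1 hi)
    push_cast
    rw [sub_add_cancel_left, abs_neg]
    exact_mod_cast this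
  unfold expMajorant
  rw [← mul_assoc]
  exact mul_le_mul_of_nonneg_right (exp_neg_mul_abs_le hl h) (Real.exp_pos _).le

theorem expMajorant_swap (l : ℝ) (a b : ℤ) : expMajorant l (b, a) = expMajorant l (a, b) :=
  mul_comm _ _

namespace IsSymmStep

variable {p : ℤ → ℝ} {r : ℕ}

theorem sum_tilted_le (hp : IsSymmStep p r) {l : ℝ} (hl : 0 ≤ l) {F : ℤ → ℝ} {B : ℝ}
    (hF : ∀ i ∈ Finset.Icc (-(r : ℤ)) r, F i ≤ B) (hB : 0 ≤ B) :
    ∑ i ∈ Finset.Icc (-(r : ℤ)) r, p i * Real.exp (-l * i) * F i ≤ Real.exp (l * r) * B := by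
  calc _ ≤ ∑ i ∈ Finset.Icc (-(r : ℤ)) r, p i * (Real.exp (l * r) * B) := by
        refine Finset.sum_le_sum fun i hi => ?_
        have h1 : Real.exp (-l * i) ≤ Real.exp (l * r) := by
          have : -(r : ℝ) ≤ i := by exact_mod_cast (Finset.mem_Icc.1 hi).1
          exact Real.exp_le_exp.2 (by nlinarith)
        rw [mul_assoc]
        refine mul_le_mul_of_nonneg_left ?_ (hp.nonneg i)
        exact (mul_le_mul_of_nonneg_left (hF i hi) (Real.exp_pos _).le).trans
          (mul_le_mul_of_nonneg_right h1 hB)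
    _ = _ := by rw [← Finset.sum_mul, hp.sum_eq_one, one_mul]

theorem abs_tiltedGen_le (hp : IsSymmStep p r) {l : ℝ} (hl : 0 ≤ l) {W : ℤ × ℤ → ℝ} {B : ℝ}
    (hB : 0 ≤ B) (hW0 : ∀ q, 0 ≤ W q) (hW : ∀ q, W q ≤ B * expMajorant l q) (q : ℤ × ℤ) :
    |tiltedGen p r l W q| ≤ 2 * Real.exp (l * r) ^ 2 * B * expMajorant l q := by
  obtain ⟨a, b⟩ := q
  set e := Real.exp (l * r)
  have he : 1 ≤ e := Real.one_le_exp (by positivity)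
  have hM := mul_nonneg hB (expMajorant_nonneg l (a, b))
  have h1 : ∑ i ∈ Finset.Icc (-(r : ℤ)) r, p i * Real.exp (-l * i) * W (a + i, b)
      ≤ e * (B * (e * expMajorant l (a, b))) :=
    hp.sum_tilted_le hl (fun i hi => (hW _).trans
      (mul_le_mul_of_nonneg_left (expMajorant_add_fst_le hl hi a b) hB))
      (mul_nonneg hB (mul_nonneg (by positivity) (expMajorant_nonneg l _)))
  have h2 : ∑ i ∈ Finset.Icc (-(r : ℤ)) r, p i * Real.exp (-l * i) * W (a, b + i)
      ≤ e * (B * (e * expMajorant l (a, b))) :=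
    hp.sum_tilted_le hl (fun i hi => (hW _).trans (mul_le_mul_of_nonneg_left (by
      rw [expMajorant_swap, ← expMajorant_swap l a b]
      exact expMajorant_add_fst_le hl hi b a) hB))
      (mul_nonneg hB (mul_nonneg (by positivity) (expMajorant_nonneg l _)))
  have h3 : ∀ F : ℤ → ℝ, (∀ i, 0 ≤ F i) →
      0 ≤ ∑ i ∈ Finset.Icc (-(r : ℤ)) r, p i * Real.exp (-l * i) * F i := fun F hF =>
    Finset.sum_nonneg fun i _ => mul_nonneg (mul_nonneg (hp.nonneg i) (Real.exp_pos _).le) (hF i)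
  have h4 := h3 (fun i => W (a + i, b)) fun i => hW0 _
  have h5 := h3 (fun i => W (a, b + i)) fun i => hW0 _
  have h6 := hW (a, b)
  have h7 := hW0 (a, b)
  have h8 := hp.nonneg (b - a)
  have h9 := hp.le_one (b - a)
  have h10 : B * expMajorant l (a, b) ≤ e ^ 2 * (B * expMajorant l (a, b)) :=
    le_mul_of_one_le_left hM (one_le_pow₀ he)
  unfold tiltedGen
  split_ifs
  · rw [abs_zero]
    exact mul_nonneg (mul_nonneg (by positivity) hB) (expMajorant_nonneg l _)
  · rw [abs_le]
    simp only at h4 h5 ⊢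
    constructor <;> nlinarith [mul_nonneg h8 h7, mul_nonneg (sub_nonneg.2 h9) h7]

theorem tiltedSource_nonneg (hp : IsSymmStep p r) (l s : ℝ) (q : ℤ × ℤ) :
    0 ≤ tiltedSource p r l s q :=
  mul_nonneg (Real.exp_pos _).le (mul_nonneg (hp.nonneg _) (sq_nonneg _))

theorem tiltedSource_le (hp : IsSymmStep p r) {l : ℝ} (hl : 0 ≤ l) {s T : ℝ} (hs : 0 ≤ s)
    (hsT : s ≤ T) (q : ℤ × ℤ) :
    tiltedSource p r l s q ≤ 2 * Real.exp (l * r) ^ 2 *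
      Real.exp (T * (stepMgf p r (2 * l) - 1)) ^ 2 * expMajorant l q := by
  obtain ⟨a, b⟩ := q
  set K := Real.exp (T * (stepMgf p r (2 * l) - 1))
  have hM := expMajorant_nonneg l (a, b)
  rcases lt_or_ge (r : ℤ) |b - a| with hr | hr
  · simp only [tiltedSource, hp.support _ hr, zero_mul, mul_zero]
    positivity
  have key : ∀ j k : ℤ, |k - j| ≤ (r : ℤ) → Real.exp (l * (j + k)) * heatFlow p r fullStep s j ^ 2
      ≤ Real.exp (l * r) ^ 2 * K ^ 2 * expMajorant l (j, k) := by
    intro j k hjk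
    have hjk' : |(k : ℝ) - j| ≤ r := by exact_mod_cast hjk
    have h1 := hp.exp_mul_heatFlow_fullStep_le hl hs hsT j
    have h0 := hp.heatFlow_nonneg fullStep_nonneg hs j
    have h2 := pow_le_pow_left₀ (mul_nonneg (Real.exp_pos _).le h0) h1 2
    have h3 : Real.exp (l * (j + k)) * heatFlow p r fullStep s j ^ 2
        = Real.exp (l * (k - j)) * (Real.exp (l * j) * heatFlow p r fullStep s j) ^ 2 := by
      have : Real.exp (l * (j + k)) = Real.exp (l * (k - j)) * Real.exp (l * j) ^ 2 := by
        rw [← Real.exp_nat_mul, ← Real.exp_add]; push_cast; ring_nf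
      rw [this]; ring
    have h4 : Real.exp (l * (k - j)) ≤ Real.exp (l * r) :=
      Real.exp_le_exp.2 (mul_le_mul_of_nonneg_left ((le_abs_self _).trans hjk') hl)
    have h5 := exp_neg_mul_abs_le hl hjk'
    rw [h3]
    calc _ ≤ Real.exp (l * r) * (K * Real.exp (-l * |(j : ℝ)|)) ^ 2 := by gcongr
      _ = Real.exp (l * r) * K ^ 2 * Real.exp (-l * |(j : ℝ)|) * Real.exp (-l * |(j : ℝ)|) := by
        ring
      _ ≤ Real.exp (l * r) * K ^ 2 * Real.exp (-l * |(j : ℝ)|)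
          * (Real.exp (l * r) * Real.exp (-l * |(k : ℝ)|)) := by gcongr
      _ = _ := by unfold expMajorant; ring
  have h1 := key a b hr
  have h2 := key b a (by rwa [abs_sub_comm])
  rw [expMajorant_swap, add_comm (b : ℝ)] at h2
  have h3 := hp.heatFlow_nonneg fullStep_nonneg hs a
  have h4 := hp.heatFlow_nonneg fullStep_nonneg hs b
  calc tiltedSource p r l s (a, b)
      ≤ Real.exp (l * (a + b)) * (1 * (heatFlow p r fullStep s a ^ 2
        + heatFlow p r fullStep s b ^ 2)) := by
        refine mul_le_mul_of_nonneg_left (mul_le_mul (hp.le_one _) ?_ (sq_nonneg _) zero_le_one)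
          (Real.exp_pos _).le
        nlinarith [mul_nonneg h3 h4]
    _ ≤ _ := by linarith

end IsSymmStep

namespace IsNegCovFlow

variable {p : ℤ → ℝ} {r : ℕ} {v : ℝ → ℤ → ℤ → ℝ}

theorem tilt_nonneg (hv : IsNegCovFlow p r v) (hp : IsSymmStep p r) (l : ℝ) {s : ℝ} (hs : 0 ≤ s)
    (q : ℤ × ℤ) : 0 ≤ tilt l (v s) q :=
  mul_nonneg (Real.exp_pos _).le (hv.nonneg hp hs _ _)

theorem tilt_le (hv : IsNegCovFlow p r v) (hp : IsSymmStep p r) {l : ℝ} (hl : 0 ≤ l) {s T : ℝ}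
    (hs : 0 ≤ s) (hsT : s ≤ T) (q : ℤ × ℤ) :
    tilt l (v s) q ≤ Real.exp (T * (stepMgf p r (2 * l) - 1)) ^ 2 * expMajorant l q := by
  have h1 := hp.exp_mul_heatFlow_fullStep_le hl hs hsT q.1
  have h2 := hp.exp_mul_heatFlow_fullStep_le hl hs hsT q.2
  have h3 := hp.heatFlow_nonneg fullStep_nonneg hs q.2
  calc tilt l (v s) q
      ≤ Real.exp (l * (q.1 + q.2)) * (heatFlow p r fullStep s q.1 * heatFlow p r fullStep s q.2) :=
        mul_le_mul_of_nonneg_left (hv.upper s hs _ _) (Real.exp_pos _).le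
    _ = (Real.exp (l * q.1) * heatFlow p r fullStep s q.1) *
        (Real.exp (l * q.2) * heatFlow p r fullStep s q.2) := by
        rw [mul_add, Real.exp_add]; ring
    _ ≤ _ := mul_le_mul h1 h2 (mul_nonneg (Real.exp_pos _).le h3) (by positivity)
    _ = _ := by unfold expMajorant; ring

theorem hasDerivWithinAt_tilt (hv : IsNegCovFlow p r v) (l : ℝ) {s : ℝ} (hs : 0 ≤ s) (q : ℤ × ℤ) :
    HasDerivWithinAt (fun s => tilt l (v s) q)
      (tiltedGen p r l (tilt l (v s)) q + tiltedSource p r l s q) (Set.Ici 0) s := by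
  obtain ⟨a, b⟩ := q
  by_cases hab : a = b
  · subst hab
    have h1 : tiltedGen p r l (tilt l (v s)) (a, a) + tiltedSource p r l s (a, a) = 0 := by
      simp [tiltedGen, tiltedSource]
    have h2 : (fun s => tilt l (v s) (a, a)) = fun _ => 0 := by
      funext s; simp [tilt, hv.diag]
    rw [h1, h2]
    exact hasDerivWithinAt_const _ _ _
  · refine ((hv.deriv a b hab s hs).const_mul (Real.exp (l * (a + b)))).congr_deriv ?_
    simp only [tiltedGen, tiltedSource, tilt, if_neg hab, stepSum, mul_add, mul_sub, Finset.mul_sum]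
    congr 1
    congr 1
    · congr 1 <;> refine Finset.sum_congr rfl fun i _ => ?_
      · have : Real.exp (l * a + l * b) = Real.exp (-l * i) * Real.exp (l * (a + i : ℤ) + l * b) := by
          rw [← Real.exp_add]; push_cast; ring_nf
        rw [this]; ring
      · have : Real.exp (l * a + l * b) = Real.exp (-l * i) * Real.exp (l * a + l * (b + i : ℤ)) := by
          rw [← Real.exp_add]; push_cast; ring_nf
        rw [this]; ring
    · ring

/-- The weighted sum of the negative covariances grows at most like `√T` times the square of the
exponential moment of one particle. -/
theorem tsum_tilt_le (hv : IsNegCovFlow p r v) (hp : IsSymmStep p r) {m : ℤ} (hm : 0 < m)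
    (hpm : 0 < p m) {l : ℝ} (hl : 0 < l) (hl1 : l ≤ 1) {T : ℝ} (hT : 0 < T) :
    Summable (tilt l (v T)) ∧ ∑' q, tilt l (v T) q
      ≤ 2 * (Real.exp (3 * r) * (2 * r) ^ 2 * √(Real.pi ^ 3 / (2 * p m))) * √T *
        Real.exp (2 * (stepMgf p r l - 1) * T) := by
  set C := Real.exp (3 * r) * (2 * r) ^ 2 * √(Real.pi ^ 3 / (2 * p m)) with hC
  set c := 2 * (stepMgf p r l - 1) with hc
  set K := Real.exp (T * (stepMgf p r (2 * l) - 1)) with hK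
  have hmaj : Summable (expMajorant l) := summable_exp_neg_mul_abs_int_prod hl
  have hsum : ∀ s ∈ Set.Icc 0 T, Summable (tilt l (v s)) := fun s hs =>
    Summable.of_nonneg_of_le (hv.tilt_nonneg hp l hs.1) (hv.tilt_le hp hl.le hs.1 hs.2)
      (hmaj.mul_left _)
  refine ⟨hsum T ⟨hT.le, le_rfl⟩, ?_⟩
  set Φ : ℝ → ℝ := fun s => ∑' q, tilt l (v s) q with hΦ
  have hcont : ContinuousOn Φ (Set.Icc 0 T) := by
    refine continuousOn_tsum (fun q s hs => ?_) (hmaj.mul_left (K ^ 2)) fun q s hs => ?_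
    · exact (hv.hasDerivWithinAt_tilt l hs.1 q).continuousWithinAt.mono Set.Icc_subset_Ici_self
    · rw [Real.norm_of_nonneg (hv.tilt_nonneg hp l hs.1 q)]
      exact hv.tilt_le hp hl.le hs.1 hs.2 q
  have hderiv : ∀ s ∈ Set.Ioo 0 T, HasDerivAt Φ
      (∑' q, (tiltedGen p r l (tilt l (v s)) q + tiltedSource p r l s q)) s := by
    intro s hs
    refine hasDerivAt_tsum_of_isPreconnected (F := ℝ) (t := Set.Ioo 0 T)
      (g := fun q s => tilt l (v s) q)
      (g' := fun q s => tiltedGen p r l (tilt l (v s)) q + tiltedSource p r l s q)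
      (u := fun q => 2 * Real.exp (l * r) ^ 2 * K ^ 2 * expMajorant l q
        + 2 * Real.exp (l * r) ^ 2 * K ^ 2 * expMajorant l q)
      ((hmaj.mul_left _).add (hmaj.mul_left _)) isOpen_Ioo isPreconnected_Ioo
      (fun q y hy => ?_) (fun q y hy => ?_) hs (hsum s ⟨hs.1.le, hs.2.le⟩) hs
    · exact (hv.hasDerivWithinAt_tilt l hy.1.le q).hasDerivAt (Ici_mem_nhds hy.1)
    · refine (norm_add_le _ _).trans (add_le_add ?_ ?_)
      · exact hp.abs_tiltedGen_le hl.le (by positivity) (hv.tilt_nonneg hp l hy.1.le)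
          (hv.tilt_le hp hl.le hy.1.le hy.2.le) q
      · rw [Real.norm_of_nonneg (hp.tiltedSource_nonneg l y q)]
        exact hp.tiltedSource_le hl.le hy.1.le hy.2.le q
  have hle : ∀ s ∈ Set.Ioo 0 T,
      ∑' q, (tiltedGen p r l (tilt l (v s)) q + tiltedSource p r l s q)
        ≤ c * Φ s + C * (Real.exp (c * s) / √s) := by
    intro s hs
    obtain ⟨h1, h2⟩ := hp.tsum_tiltedGen_le l (hv.tilt_nonneg hp l hs.1.le)
      (fun j => by simp [tilt, hv.diag]) (hsum s ⟨hs.1.le, hs.2.le⟩)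
    have h3 : Summable (tiltedSource p r l s) :=
      Summable.of_nonneg_of_le (hp.tiltedSource_nonneg l s)
        (hp.tiltedSource_le hl.le hs.1.le hs.2.le) (hmaj.mul_left _)
    rw [h1.tsum_add h3]
    exact add_le_add h2 (hp.tsum_source_le hm hpm hl.le hl1 hs.1)
  set G : ℝ → ℝ := fun s => Real.exp (-c * s) * Φ s - 2 * C * √s with hG
  have hGd : ∀ s ∈ Set.Ioo 0 T, HasDerivAt G
      (Real.exp (-c * s) * (-c) * Φ s + Real.exp (-c * s) *
        (∑' q, (tiltedGen p r l (tilt l (v s)) q + tiltedSource p r l s q))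
        - 2 * C * (1 / (2 * √s))) s := by
    intro s hs
    have h1 : HasDerivAt (fun s => Real.exp (-c * s)) (Real.exp (-c * s) * (-c)) s := by
      simpa using ((hasDerivAt_id s).const_mul (-c)).exp
    exact (h1.mul (hderiv s hs)).sub ((Real.hasDerivAt_sqrt hs.1.ne').const_mul _)
  have hGa : AntitoneOn G (Set.Icc 0 T) := by
    refine antitoneOn_of_deriv_nonpos (convex_Icc 0 T) ?_ ?_ ?_
    · exact ((by fun_prop : ContinuousOn (fun s => Real.exp (-c * s)) (Set.Icc 0 T)).mul hcont).sub
        (by fun_prop)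
    · rw [interior_Icc]
      exact fun s hs => (hGd s hs).differentiableAt.differentiableWithinAt
    · rw [interior_Icc]
      intro s hs
      rw [(hGd s hs).deriv]
      have h1 := mul_le_mul_of_nonneg_left (hle s hs) (Real.exp_pos (-c * s)).le
      have h2 : Real.exp (-c * s) * Real.exp (c * s) = 1 := by
        rw [← Real.exp_add]; simp
      have h3 : Real.exp (-c * s) * (c * Φ s + C * (Real.exp (c * s) / √s))
          = Real.exp (-c * s) * c * Φ s + C / √s := by
        linear_combination (C / √s) * h2
      have h4 : 2 * C * (1 / (2 * √s)) = C / √s := by ring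
      rw [h4]
      linarith
  have h0 : G 0 = 0 := by simp [hG, hΦ, tilt, hv.init]
  have h1 := hGa ⟨le_rfl, hT.le⟩ ⟨hT.le, le_rfl⟩ hT.le
  rw [h0] at h1
  have h2 := mul_le_mul_of_nonneg_right (sub_nonpos.1 h1) (Real.exp_pos (c * T)).le
  rwa [mul_right_comm, ← Real.exp_add, neg_mul, neg_add_cancel, Real.exp_zero, one_mul] at h2

end IsNegCovFlow

theorem IsSymmStep.of_tsum {p : ℤ → ℝ} {r : ℕ} (hp0 : ∀ i, 0 ≤ p i) (hsym : ∀ i, p (-i) = p i)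
    (hsum : ∑' i : ℤ, p i = 1) (hfin : ∀ i : ℤ, (r : ℤ) < |i| → p i = 0) : IsSymmStep p r where
  nonneg := hp0
  symm := hsym
  support := hfin
  sum_eq_one := by
    rw [← hsum, eq_comm]
    refine _root_.tsum_eq_sum fun i hi => hfin i ?_
    by_contra hc
    exact hi (Finset.mem_Icc.2 (abs_le.1 (not_lt.1 hc)))

theorem IsSymmStep.exists_pos {p : ℤ → ℝ} {r : ℕ} (hp : IsSymmStep p r)
    (hV : ∑ i ∈ Finset.Icc (-(r : ℤ)) r, p i * (i : ℝ) ^ 2 ≠ 0) : ∃ m : ℤ, 0 < m ∧ 0 < p m := by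
  obtain ⟨i, -, hi⟩ := Finset.exists_ne_zero_of_sum_ne_zero hV
  have h1 : 0 < p i := (hp.nonneg i).lt_of_ne' (left_ne_zero_of_mul hi)
  have h2 : i ≠ 0 := by rintro rfl; simp at hi
  rcases lt_or_gt_of_ne h2 with h | h
  · exact ⟨-i, by omega, by rwa [hp.symm]⟩
  · exact ⟨i, h, h1⟩

theorem IsSymmStep.stepMgf_sub_one_le {p : ℤ → ℝ} {r : ℕ} (hp : IsSymmStep p r) {l : ℝ}
    (hl : 0 ≤ l) (hlr : l * r ≤ 1) :
    stepMgf p r l - 1 ≤ l ^ 2 / 2 * ∑ i ∈ Finset.Icc (-(r : ℤ)) r, p i * (i : ℝ) ^ 2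
      + (l * r) ^ 4 := by
  have h : ∀ i ∈ Finset.Icc (-(r : ℤ)) r,
      p i * Real.cosh (l * i) ≤ p i * (1 + (l ^ 2 / 2 * (i : ℝ) ^ 2 + (l * r) ^ 4)) := by
    intro i hi
    refine mul_le_mul_of_nonneg_left ?_ (hp.nonneg i)
    have hi' : |(i : ℝ)| ≤ r := by exact_mod_cast abs_le.2 (Finset.mem_Icc.1 hi)
    have h1 : (l * i) ^ 2 ≤ (l * r) ^ 2 := by
      rw [← sq_abs (l * (i : ℝ)), abs_mul, abs_of_nonneg hl]
      gcongr
    have h2 : (l * r) ^ 2 ≤ 1 := pow_le_one₀ (by positivity) hlr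
    have h3 := sq_nonneg (l * (i : ℝ))
    have h4 := (abs_le.1 (Real.abs_exp_sub_one_sub_id_le
      (x := (l * i) ^ 2 / 2) (by rw [abs_of_nonneg (by positivity)]; linarith))).2
    have h5 := Real.cosh_le_exp_half_sq (l * i)
    nlinarith [mul_le_mul h1 h1 h3 (sq_nonneg _)]
  have hs := Finset.sum_le_sum h
  rw [← hp.stepMgf_eq_cosh] at hs
  simp only [mul_add, Finset.sum_add_distrib, mul_one, hp.sum_eq_one, ← Finset.sum_mul,
    one_mul] at hs
  simp only [mul_left_comm (p _) (l ^ 2 / 2), ← Finset.mul_sum] at hs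
  linarith

theorem IsNegCovFlow.tsum_tail_le {p : ℤ → ℝ} {r : ℕ} {v : ℝ → ℤ → ℤ → ℝ}
    (hv : IsNegCovFlow p r v) (hp : IsSymmStep p r) {l : ℝ} (hl : 0 ≤ l) {s : ℝ} (hs : 0 ≤ s)
    (hsum : Summable (tilt l (v s))) (z : ℝ) :
    (∑' q : ℤ × ℤ, if q.1 ≠ q.2 ∧ z < (q.1 : ℝ) ∧ z < (q.2 : ℝ) then v s q.1 q.2 else 0)
      ≤ Real.exp (-(2 * (l * z))) * ∑' q, tilt l (v s) q := by
  rw [← tsum_mul_left]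
  have hle : ∀ q : ℤ × ℤ,
      (if q.1 ≠ q.2 ∧ z < (q.1 : ℝ) ∧ z < (q.2 : ℝ) then v s q.1 q.2 else 0)
        ≤ Real.exp (-(2 * (l * z))) * tilt l (v s) q := fun q => by
    split_ifs with h
    · rw [tilt, ← mul_assoc, ← Real.exp_add]
      exact le_mul_of_one_le_left (hv.nonneg hp hs _ _)
        (Real.one_le_exp (by nlinarith [h.2.1, h.2.2]))
    · exact mul_nonneg (Real.exp_pos _).le (hv.tilt_nonneg hp l hs q)
  refine Summable.tsum_le_tsum hle (Summable.of_nonneg_of_le (fun q => ?_) hle (hsum.mul_left _))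
    (hsum.mul_left _)
  split_ifs
  exacts [hv.nonneg hp hs _ _, le_rfl]

theorem tendsto_sqrt_log_div_self_atTop :
    Tendsto (fun t : ℝ => √(Real.log t / t)) atTop (𝓝 0) := by
  simpa using Real.isLittleO_log_id_atTop.tendsto_div_nhds_zero.sqrt

theorem IsNegCovFlow.exists_tsum_tail_le {p : ℤ → ℝ} {r : ℕ} {v : ℝ → ℤ → ℤ → ℝ}
    (hv : IsNegCovFlow p r v) (hp : IsSymmStep p r) {σ : ℝ} (hσ : 0 < σ)
    (hV : σ ^ 2 = ∑ i ∈ Finset.Icc (-(r : ℤ)) r, p i * (i : ℝ) ^ 2) (x : ℝ) :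
    ∃ C T : ℝ, 0 ≤ T ∧ ∀ t : ℝ, T ≤ t →
      (∑' q : ℤ × ℤ, if q.1 ≠ q.2
            ∧ σ * √(t / Real.log t)
                * (x + Real.log (t / (√(2 * Real.pi) * Real.log t))) < (q.1 : ℝ)
            ∧ σ * √(t / Real.log t)
                * (x + Real.log (t / (√(2 * Real.pi) * Real.log t))) < (q.2 : ℝ) then
          v t q.1 q.2 else 0)
      ≤ C * Real.exp (-2 * x) * (Real.log t) ^ 2 / √t := by
  obtain ⟨m, hm, hpm⟩ := hp.exists_pos (hV ▸ (by positivity))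
  set C₀ := Real.exp (3 * r) * (2 * r) ^ 2 * √(Real.pi ^ 3 / (2 * p m)) with hC₀
  set D := Real.exp (2 * r ^ 4 / σ ^ 4) with hD
  have hl0 : Tendsto (fun t : ℝ => √(Real.log t / t) / σ) atTop (𝓝 0) := by
    simpa using tendsto_sqrt_log_div_self_atTop.div_const σ
  have ev1 : ∀ᶠ t : ℝ in atTop, √(Real.log t / t) / σ < 1 / (r + 1) :=
    hl0.eventually_lt_const (by positivity)
  have ev2 : ∀ᶠ t : ℝ in atTop, Real.log t ^ 2 ≤ t := by
    filter_upwards [(Real.isLittleO_pow_log_id_atTop (n := 2)).bound one_pos,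
      eventually_ge_atTop 0] with t ht ht0
    simpa [abs_of_nonneg ht0] using ht
  obtain ⟨T, hT⟩ := eventually_atTop.1 ((ev1.and ev2).and (eventually_gt_atTop 1))
  refine ⟨4 * Real.pi * C₀ * D, max T 0, le_max_right _ _, fun t ht => ?_⟩
  obtain ⟨⟨h1, h2⟩, h3⟩ := hT t ((le_max_left _ _).trans ht)
  set L := Real.log t with hL
  have ht0 : 0 < t := by linarith
  have hL0 : 0 < L := Real.log_pos h3
  set l := √(L / t) / σ with hl
  have hlpos : 0 < l := by positivity
  have hr1 : (0 : ℝ) < r + 1 := by positivity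
  have hlr : l * (r + 1) ≤ 1 := ((lt_div_iff₀ hr1).1 h1).le
  have hl1 : l ≤ 1 := by nlinarith [(Nat.cast_nonneg r : (0 : ℝ) ≤ r)]
  have hlr' : l * r ≤ 1 := by nlinarith
  set A := Real.log (t / (√(2 * Real.pi) * L)) with hA
  obtain ⟨hs, hle⟩ := hv.tsum_tilt_le hp hm hpm hlpos hl1 ht0
  refine (hv.tsum_tail_le hp hlpos.le ht0.le hs _).trans ?_
  have hlz : l * (σ * √(t / L) * (x + A)) = x + A := by
    have : √(L / t) * √(t / L) = 1 := by
      rw [← Real.sqrt_mul (by positivity), div_mul_div_comm, mul_comm, div_self (by positivity),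
        Real.sqrt_one]
    rw [hl]
    field_simp
    linear_combination (x + A) * this
  have hexpA : Real.exp (-(2 * (x + A))) = Real.exp (-2 * x) * (2 * Real.pi * L ^ 2 / t ^ 2) := by
    have hq : 0 < t / (√(2 * Real.pi) * L) := by positivity
    have h5 : Real.exp (-(2 * (x + A))) = Real.exp (-2 * x) * (Real.exp A ^ 2)⁻¹ := by
      rw [← Real.exp_nat_mul, ← Real.exp_neg, ← Real.exp_add]; push_cast; ring_nf
    rw [h5, hA, Real.exp_log hq, div_pow, mul_pow, Real.sq_sqrt (by positivity), inv_div]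
  have hl2 : l ^ 2 = L / t / σ ^ 2 := by rw [hl, div_pow, Real.sq_sqrt (by positivity)]
  have hmgf : Real.exp (2 * (stepMgf p r l - 1) * t) ≤ t * D := by
    have h6 := hp.stepMgf_sub_one_le hlpos.le hlr'
    rw [← hV] at h6
    have h7 : 2 * (l ^ 2 / 2 * σ ^ 2) * t = L := by rw [hl2]; field_simp
    have h8 : 2 * (l * r) ^ 4 * t ≤ 2 * r ^ 4 / σ ^ 4 := by
      have h9 : 2 * (l * r) ^ 4 * t = 2 * r ^ 4 / σ ^ 4 * (L ^ 2 / t) := by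
        rw [show (l * r) ^ 4 = (l ^ 2) ^ 2 * r ^ 4 by ring, hl2]; field_simp
      rw [h9]
      exact mul_le_of_le_one_right (by positivity) ((div_le_one ht0).2 h2)
    have h10 : Real.exp L = t := Real.exp_log ht0
    rw [hD, ← h10, ← Real.exp_add, h10]
    refine Real.exp_le_exp.2 ?_
    nlinarith [mul_le_mul_of_nonneg_right h6 ht0.le]
  rw [hlz, hexpA]
  calc _ ≤ Real.exp (-2 * x) * (2 * Real.pi * L ^ 2 / t ^ 2) * (2 * C₀ * √t * (t * D)) := by
        refine mul_le_mul_of_nonneg_left (hle.trans ?_) (by positivity)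
        exact mul_le_mul_of_nonneg_left hmgf (by positivity)
    _ = _ := by
        have h11 : √t * √t = t := Real.mul_self_sqrt ht0.le
        have h12 : √t / t = 1 / √t := by
          rw [div_eq_div_iff ht0.ne' (by positivity), h11, one_mul]
        calc _ = 4 * Real.pi * C₀ * D * Real.exp (-2 * x) * L ^ 2 * (√t / t) := by
              field_simp; ring
          _ = _ := by rw [h12]; ring

/-- Covariance bound for finite-range symmetric exclusion from the full step:
with `z = σ b_t(x+a_t)`, `a_t = log(t/(√(2π)log t))`, `b_t = √(t/log t)`, the
covariance sum `𝒞_t(η,z) = -∑_{j≠k, j,k>z} Cov_η(η_t(j),η_t(k))` is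
`O(e^{-2x}(log t)²/√t)` as `t → ∞`.  The two-point function `h` of the
exclusion process is characterized by the two-particle Kolmogorov equation. -/
theorem stmt13 (p : ℤ → ℝ) (hp0 : ∀ i, 0 ≤ p i) (hsym : ∀ i, p (-i) = p i)
    (hsum : ∑' i : ℤ, p i = 1)
    (hirr : ∀ x : ℤ, ∃ n : ℕ, 0 < convPow p n x)
    (θ : ℝ) (hθ : 0 < θ)
    (hexp : Summable fun i : ℤ => Real.exp (θ * (i : ℝ)) * p i)
    (σ : ℝ) (hσ : 0 < σ) (hσ2 : σ ^ 2 = ∑' i : ℤ, (i : ℝ) ^ 2 * p i)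
    (r : ℕ) (hfin : ∀ i : ℤ, (r : ℤ) < |i| → p i = 0)
    (h : ℝ → ℤ → ℤ → ℝ)
    (h0 : ∀ j k : ℤ, j ≠ k →
      h 0 j k = (if j ≤ 0 then (1:ℝ) else 0) * (if k ≤ 0 then (1:ℝ) else 0))
    (hbdd : ∀ (t : ℝ) (j k : ℤ), 0 ≤ h t j k ∧ h t j k ≤ 1)
    (hderiv : ∀ j k : ℤ, j ≠ k → ∀ t : ℝ, 0 ≤ t →
      HasDerivWithinAt (fun s => h s j k) (twoGen p (h t) j k) (Set.Ici 0) t)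
    (x : ℝ) :
    ∃ C T : ℝ, ∀ t : ℝ, T ≤ t →
      (∑' q : ℤ × ℤ, if q.1 ≠ q.2
            ∧ σ * Real.sqrt (t / Real.log t)
                * (x + Real.log (t / (Real.sqrt (2 * Real.pi) * Real.log t))) < (q.1 : ℝ)
            ∧ σ * Real.sqrt (t / Real.log t)
                * (x + Real.log (t / (Real.sqrt (2 * Real.pi) * Real.log t))) < (q.2 : ℝ) then
          oneP p (fun k => if k ≤ 0 then (1:ℝ) else 0) t q.1
              * oneP p (fun k => if k ≤ 0 then (1:ℝ) else 0) t q.2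
            - h t q.1 q.2
        else 0)
      ≤ C * Real.exp (-2 * x) * (Real.log t) ^ 2 / Real.sqrt t := by
  have hp := IsSymmStep.of_tsum hp0 hsym hsum hfin
  have hV : σ ^ 2 = ∑ i ∈ Finset.Icc (-(r : ℤ)) r, p i * (i : ℝ) ^ 2 := by
    rw [hσ2, ← hp.tsum_eq_sum]
    exact tsum_congr fun i => mul_comm _ _
  obtain ⟨C, T, hT, hC⟩ := (hp.isNegCovFlow h0 hbdd hderiv).exists_tsum_tail_le hp hσ hV x
  refine ⟨C, T, fun t ht => le_of_eq_of_le (tsum_congr fun q => ?_) (hC t ht)⟩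
  have h1 := hp.oneP_eq_heatFlow fullStep_nonneg fullStep_le_one (hT.trans ht)
  split_ifs with hq hq'
  · exact absurd hq' hq.1
  · rw [← h1, ← h1]
    rfl
  · rfl
end
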